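/- arXiv:2409.18363 — 3 statements merged into one kernel-verified Lean document; each statement's English description precedes it below -/
import Mathlib

section
/- Quantitative multi-dimensional polynomial Bogolyubov theorem (Theorem D): Let P = (P₁, …, P_d) : ℤ^d → ℤ^d be an integer polynomial map with zero constant term such that every non-trivial rational linear combination of the components P₁, …, P_d has degree at least 2 (i.e., for all (a₁, …, a_d) ∈ ℚ^d not all zero, the polynomial a₁P₁ + … + a_dP_d has degree ≥ 2). Then for every real δ > 0 there exists a positive integer k = k(P, δ) such that for every E ⊆ ℤ^d with upper Banach density d*(E) ≥ δ one has kℤ^d ⊆ (E − E) + P(E − E); that is, for every m ∈ ℤ^d there exist x₁, x₂, y₁, y₂ ∈ E with km = (x₁ − x₂) + P(y₁ − y₂). -/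
open MeasureTheory Filter
open scoped symmDiff

/-- Upper Banach density of a set `E ⊆ ℤ^d`:
`d*(E) = limsup_N sup_t |E ∩ (Q_N + t)| / |Q_N|` where `Q_N = [-N, N]^d ∩ ℤ^d`. -/
noncomputable def upperBanachDensity (d : ℕ) (E : Set (Fin d → ℤ)) : ℝ :=
  Filter.atTop.limsup fun N : ℕ =>
    ⨆ t : Fin d → ℤ,
      ((E ∩ {x | ∀ i, |x i - t i| ≤ (N : ℤ)}).ncard : ℝ) / ((2 * N + 1 : ℝ) ^ d)

section

open Finset fwdDiff

/-- The box `[-M, M]^d` in `ℤ^d`. -/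
noncomputable def cube (d M : ℕ) : Finset (Fin d → ℤ) :=
  Fintype.piFinset fun _ => Finset.Icc (-(M : ℤ)) M

theorem mem_cube {d M : ℕ} {v : Fin d → ℤ} : v ∈ cube d M ↔ ∀ i, |v i| ≤ (M : ℤ) := by
  simp [cube, abs_le]

theorem card_cube (d M : ℕ) : #(cube d M) = (2 * M + 1) ^ d := by
  simp only [cube, Fintype.card_piFinset, Int.card_Icc, prod_const, card_univ, Fintype.card_fin]
  congr 1
  omega

theorem card_cube_pos (d M : ℕ) : 0 < #(cube d M) := by
  rw [card_cube]; positivity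

theorem zero_mem_cube (d M : ℕ) : (0 : Fin d → ℤ) ∈ cube d M := by
  simp [mem_cube]

theorem cube_mono {d M N : ℕ} (h : M ≤ N) : cube d M ⊆ cube d N := fun v hv => by
  rw [mem_cube] at *
  exact fun i => (hv i).trans (by exact_mod_cast h)

theorem card_cube_mul_le (d M c : ℕ) (hc : 1 ≤ c) : #(cube d (c * M)) ≤ c ^ d * #(cube d M) := by
  rw [card_cube, card_cube, ← mul_pow]
  exact Nat.pow_le_pow_left (by nlinarith) d

theorem add_mem_cube {d M N : ℕ} {u v : Fin d → ℤ} (hu : u ∈ cube d M) (hv : v ∈ cube d N) :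
    u + v ∈ cube d (M + N) := by
  rw [mem_cube] at *
  intro i
  push_cast
  exact (abs_add_le _ _).trans (add_le_add (hu i) (hv i))

theorem sub_mem_cube {d M N : ℕ} {u v : Fin d → ℤ} (hu : u ∈ cube d M) (hv : v ∈ cube d N) :
    u - v ∈ cube d (M + N) := by
  rw [mem_cube] at *
  intro i
  push_cast
  exact (abs_sub _ _).trans (add_le_add (hu i) (hv i))

theorem nsmul_mem_cube {d M : ℕ} {u : Fin d → ℤ} (hu : u ∈ cube d M) (n : ℕ) :
    n • u ∈ cube d (n * M) := by
  rw [mem_cube] at *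
  intro i
  simp only [Pi.smul_apply, nsmul_eq_mul, abs_mul, Nat.abs_cast, Nat.cast_mul]
  exact mul_le_mul_of_nonneg_left (hu i) (by positivity)

theorem exists_mem_cube {d : ℕ} (v : Fin d → ℤ) : ∃ M, v ∈ cube d M := by
  refine ⟨∑ i, (v i).natAbs, mem_cube.2 fun i => ?_⟩
  rw [Int.abs_eq_natAbs]
  exact_mod_cast single_le_sum (f := fun i => (v i).natAbs) (fun _ _ => Nat.zero_le _) (mem_univ i)

theorem exists_subset_cube {d : ℕ} (S : Finset (Fin d → ℤ)) : ∃ M, S ⊆ cube d M := by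
  choose f hf using exists_mem_cube (d := d)
  exact ⟨S.sup f, fun v hv => cube_mono (le_sup hv) (hf v)⟩

section PhaseDist

variable {A : Type*} [AddCommGroup A]

/-- The distance from `1` of the value of a unitary character. -/
noncomputable def phaseDist (χ : AddChar A Circle) (a : A) : ℝ := ‖(χ a : ℂ) - 1‖

theorem phaseDist_nonneg (χ : AddChar A Circle) (a : A) : 0 ≤ phaseDist χ a := norm_nonneg _

@[simp] theorem phaseDist_zero (χ : AddChar A Circle) : phaseDist χ 0 = 0 := by
  simp [phaseDist]

theorem phaseDist_add_le (χ : AddChar A Circle) (a b : A) :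
    phaseDist χ (a + b) ≤ phaseDist χ a + phaseDist χ b := by
  have h : (χ (a + b) : ℂ) - 1 = ((χ a : ℂ) - 1) * χ b + ((χ b : ℂ) - 1) := by
    rw [AddChar.map_add_eq_mul, Circle.coe_mul]; ring
  unfold phaseDist
  rw [h]
  exact (norm_add_le _ _).trans (by rw [norm_mul, Circle.norm_coe, mul_one])

@[simp] theorem phaseDist_neg (χ : AddChar A Circle) (a : A) :
    phaseDist χ (-a) = phaseDist χ a := by
  have h : (χ (-a) : ℂ) - 1 = -((χ a : ℂ) - 1) * χ (-a) := by
    have : (χ a : ℂ) * χ (-a) = 1 := by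
      rw [← Circle.coe_mul, ← AddChar.map_add_eq_mul]; simp
    linear_combination this
  unfold phaseDist
  rw [h, norm_mul, norm_neg, Circle.norm_coe, mul_one]

theorem phaseDist_sub_le (χ : AddChar A Circle) (a b : A) :
    phaseDist χ (a - b) ≤ phaseDist χ a + phaseDist χ b := by
  simpa [sub_eq_add_neg] using phaseDist_add_le χ a (-b)

theorem phaseDist_nsmul_le (χ : AddChar A Circle) (n : ℕ) (a : A) :
    phaseDist χ (n • a) ≤ n * phaseDist χ a := by
  induction n with
  | zero => simp
  | succ n ih =>
    rw [succ_nsmul]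
    push_cast
    linarith [phaseDist_add_le χ (n • a) a]

theorem phaseDist_sum_le {ι : Type*} (χ : AddChar A Circle) (S : Finset ι) (f : ι → A) :
    phaseDist χ (∑ i ∈ S, f i) ≤ ∑ i ∈ S, phaseDist χ (f i) := by
  classical
  induction S using Finset.induction_on with
  | empty => simp
  | insert i S hi ih =>
    rw [sum_insert hi, sum_insert hi]
    linarith [phaseDist_add_le χ (f i) (∑ i ∈ S, f i)]

theorem norm_char_sub_char (χ : AddChar A Circle) (a b : A) :
    ‖(χ a : ℂ) - χ b‖ = phaseDist χ (a - b) := by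
  have h : (χ a : ℂ) - χ b = ((χ (a - b) : ℂ) - 1) * χ b := by
    rw [sub_mul, ← Circle.coe_mul, ← AddChar.map_add_eq_mul]; simp
  rw [h, norm_mul, Circle.norm_coe, mul_one, phaseDist]

end PhaseDist

section IsPolyMap

variable {V A : Type*} [AddCommGroup V] [AddCommGroup A]

/-- Polynomial maps of degree at most `s` between abelian groups, in the sense of finite
differences. -/
def IsPolyMap : ℕ → (V → A) → Prop
  | 0, F => ∀ h, Δ_[h] F = 0
  | s + 1, F => ∀ h, IsPolyMap s (Δ_[h] F)

theorem fwdDiff_iter_fwdDiff_apply (s : ℕ) (v h y : V) (F : V → A) :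
    (Δ_[v])^[s] (Δ_[h] F) y = (Δ_[v])^[s] F (y + h) - (Δ_[v])^[s] F y := by
  induction s generalizing F with
  | zero => rfl
  | succ s ih =>
    have : Δ_[v] (Δ_[h] F) = Δ_[h] (Δ_[v] F) := by
      ext x
      simp only [fwdDiff, add_right_comm x h v]
      abel
    rw [Function.iterate_succ_apply, this, ih, Function.iterate_succ_apply]

theorem IsPolyMap.fwdDiff_iter_eq {s : ℕ} {F : V → A} (hF : IsPolyMap s F) (v x y : V) :
    (Δ_[v])^[s] F x = (Δ_[v])^[s] F y := by
  induction s generalizing F with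
  | zero =>
    have h := congrFun (hF (x - y)) y
    simp only [fwdDiff, Pi.zero_apply, add_sub_cancel] at h
    simpa [sub_eq_zero] using h
  | succ s ih =>
    rw [Function.iterate_succ_apply]
    exact ih (hF v)

theorem IsPolyMap.fwdDiff_iter_add_nsmul {s : ℕ} {F : V → A} (hF : IsPolyMap (s + 1) F)
    (v x : V) (q : ℕ) :
    (Δ_[v])^[s] F (x + q • v) - (Δ_[v])^[s] F x = q • (Δ_[v])^[s + 1] F 0 := by
  induction q with
  | zero => simp
  | succ q ih =>
    have h : (Δ_[v])^[s] F (x + q • v + v) - (Δ_[v])^[s] F (x + q • v) = (Δ_[v])^[s + 1] F 0 := by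
      rw [hF.fwdDiff_iter_eq v 0 (x + q • v), Function.iterate_succ_apply']
      rfl
    rw [succ_nsmul, succ_nsmul, ← add_assoc, ← ih, ← h]
    abel

end IsPolyMap

theorem exists_add_nsmul_mem {V : Type*} [AddCommGroup V] [DecidableEq V] (S T : Finset V) (v : V)
    (C : ℕ) (hST : ∀ x ∈ S, ∀ j < C, x + j • v ∈ T) (hcard : #T < C * #S) :
    ∃ x ∈ S, ∃ q, 0 < q ∧ q < C ∧ x + q • v ∈ S := by
  obtain ⟨⟨x, j⟩, hxj, ⟨y, l⟩, hyl, hne, heq⟩ :=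
    exists_ne_map_eq_of_card_lt_of_maps_to (s := S ×ˢ range C) (t := T)
      (f := fun z => z.1 + z.2 • v) (by simpa [mul_comm] using hcard) (by
        rintro ⟨x, j⟩ h
        simp only [mem_coe, mem_product, mem_range] at h
        exact hST x h.1 j h.2)
  simp only [mem_product, mem_range] at hxj hyl heq
  have key : ∀ x y : V, ∀ j l : ℕ, x ∈ S → y ∈ S → j < l → l < C → x + j • v = y + l • v →
      ∃ x ∈ S, ∃ q, 0 < q ∧ q < C ∧ x + q • v ∈ S := by
    intro x y j l hx hy hjl hl h
    refine ⟨y, hy, l - j, by omega, by omega, ?_⟩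
    have : y + (l - j) • v = x := by
      have h2 : l • v = j • v + (l - j) • v := by rw [← add_nsmul]; congr 1; omega
      rw [h2] at h
      have h3 : x + j • v = (y + (l - j) • v) + j • v := by rw [h]; abel
      exact (add_right_cancel h3).symm
    rwa [this]
  rcases lt_trichotomy j l with h | h | h
  · exact key x y j l hxj.1 hyl.1 h hyl.2 heq
  · subst h
    exact absurd (by rw [add_right_cancel heq]) hne
  · exact key y x l j hyl.1 hxj.1 h hxj.2 heq.symm

theorem sum_cube_cube_eq {d : ℕ} (M : ℕ) (t : (Fin d → ℤ) → (Fin d → ℤ) → ℂ) :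
    ∑ b ∈ cube d M, ∑ b' ∈ cube d M, t b b' =
      ∑ h ∈ cube d (2 * M), ∑ b ∈ cube d M, if b - h ∈ cube d M then t b (b - h) else 0 := by
  rw [sum_comm (s := cube d (2 * M))]
  refine sum_congr rfl fun b hb => ?_
  rw [← sum_filter]
  refine sum_nbij' (fun b' => b - b') (fun h => b - h) ?_ ?_ ?_ ?_ ?_
  · intro b' hb'
    rw [mem_filter, sub_sub_cancel, two_mul]
    exact ⟨sub_mem_cube hb hb', hb'⟩
  · intro h hh
    exact (mem_filter.1 hh).2
  · simp
  · simp
  · simp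

theorem exists_many_large {ι : Type*} (H : Finset ι) (T : ι → ℝ) (c κ m : ℝ)
    (hT : ∀ h ∈ H, T h ≤ m) (hc : 0 ≤ c)
    (hsum : κ ≤ ∑ h ∈ H, T h) : κ - c * #H ≤ #{h ∈ H | c ≤ T h} * m := by
  have h1 : ∑ h ∈ H, T h ≤ ∑ h ∈ H, ((if c ≤ T h then m else 0) + c) := by
    refine sum_le_sum fun h hh => ?_
    split_ifs with hc'
    · linarith [hT h hh]
    · linarith
  rw [sum_add_distrib, ← sum_filter, sum_const, sum_const, nsmul_eq_mul, nsmul_eq_mul] at h1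
  linarith

theorem norm_sum_sum_char_le {d : ℕ} (M : ℕ) {A : Type*} [AddCommGroup A] (F : (Fin d → ℤ) → A)
    (χ : AddChar A Circle) (g : (Fin d → ℤ) → ℂ) (hg : ∀ b, ‖g b‖ ≤ 1) :
    ‖∑ a ∈ cube d M, ∑ b ∈ cube d M, g b * χ (F (a - b))‖ ≤ (#(cube d M) : ℝ) ^ 2 := by
  refine (norm_sum_le_of_le _ fun a _ => norm_sum_le_of_le _ (f := _) (n := fun _ => (1 : ℝ))
    fun b _ => ?_).trans ?_
  · rw [norm_mul, Circle.norm_coe, mul_one]; exact hg b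
  · simp [sq]

theorem sq_norm_sum_sum_char_le {d : ℕ} (M : ℕ) {A : Type*} [AddCommGroup A]
    (F : (Fin d → ℤ) → A) (χ : AddChar A Circle) (f g : (Fin d → ℤ) → ℂ) (hf : ∀ a, ‖f a‖ ≤ 1) :
    ‖∑ a ∈ cube d M, ∑ b ∈ cube d M, f a * g b * χ (F (a - b))‖ ^ 2 ≤
      #(cube d M) * ∑ h ∈ cube d (2 * M), ‖∑ a ∈ cube d M, ∑ b ∈ cube d M,
        (if b - h ∈ cube d M then g (b - h) * starRingEnd ℂ (g b) else 0) *
          χ (Δ_[h] F (a - b))‖ := by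
  set u : (Fin d → ℤ) → ℂ := fun a => ∑ b ∈ cube d M, g b * χ (F (a - b)) with hu
  have h1 : ‖∑ a ∈ cube d M, ∑ b ∈ cube d M, f a * g b * χ (F (a - b))‖ ≤
      ∑ a ∈ cube d M, ‖u a‖ := by
    refine norm_sum_le_of_le _ fun a _ => ?_
    simp only [mul_assoc, ← mul_sum]
    rw [norm_mul]
    exact mul_le_of_le_one_left (norm_nonneg _) (hf a)
  have h2 : (∑ a ∈ cube d M, ‖u a‖) ^ 2 ≤ #(cube d M) * ∑ a ∈ cube d M, ‖u a‖ ^ 2 :=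
    sq_sum_le_card_mul_sum_sq
  have h3 : ((∑ a ∈ cube d M, ‖u a‖ ^ 2 : ℝ) : ℂ) =
      ∑ h ∈ cube d (2 * M), ∑ a ∈ cube d M, ∑ b ∈ cube d M,
        (if b - h ∈ cube d M then g (b - h) * starRingEnd ℂ (g b) else 0) *
          χ (Δ_[h] F (a - b)) := by
    rw [sum_comm]
    push_cast
    refine sum_congr rfl fun a _ => ?_
    rw [← Complex.mul_conj', mul_comm, hu]
    simp only [map_sum, sum_mul_sum]
    rw [sum_cube_cube_eq]
    refine sum_congr rfl fun h _ => sum_congr rfl fun b _ => ?_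
    split_ifs
    · have : (χ (Δ_[h] F (a - b)) : ℂ) = χ (F (a - (b - h))) * starRingEnd ℂ (χ (F (a - b))) := by
        rw [← Circle.coe_inv_eq_conj, ← Circle.coe_mul, fwdDiff, AddChar.map_sub_eq_div,
          div_eq_mul_inv, sub_add]
      rw [this, map_mul]
      ring
    · simp
  have h4 : ∑ a ∈ cube d M, ‖u a‖ ^ 2 ≤ ∑ h ∈ cube d (2 * M), ‖∑ a ∈ cube d M, ∑ b ∈ cube d M,
        (if b - h ∈ cube d M then g (b - h) * starRingEnd ℂ (g b) else 0) *
          χ (Δ_[h] F (a - b))‖ := by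
    have : ∑ a ∈ cube d M, ‖u a‖ ^ 2 = ‖((∑ a ∈ cube d M, ‖u a‖ ^ 2 : ℝ) : ℂ)‖ := by
      rw [Complex.norm_real, Real.norm_of_nonneg (by positivity)]
    rw [this, h3]
    exact norm_sum_le _ _
  calc _ ≤ (∑ a ∈ cube d M, ‖u a‖) ^ 2 := by gcongr
    _ ≤ _ := h2
    _ ≤ _ := by gcongr

theorem exists_many_differences {d M : ℕ} {A : Type*} [AddCommGroup A] {F : (Fin d → ℤ) → A}
    {χ : AddChar A Circle} {f g : (Fin d → ℤ) → ℂ} (hf : ∀ a, ‖f a‖ ≤ 1) (hg : ∀ b, ‖g b‖ ≤ 1)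
    {ε : ℝ} (hε : 0 < ε) (hlarge : ε * (#(cube d M) : ℝ) ^ 2 ≤
      ‖∑ a ∈ cube d M, ∑ b ∈ cube d M, f a * g b * χ (F (a - b))‖) :
    ∃ S ⊆ cube d (2 * M), ε ^ 2 / 2 * #(cube d M) ≤ #S ∧
      ∀ h ∈ S, ∃ g' : (Fin d → ℤ) → ℂ, (∀ b, ‖g' b‖ ≤ 1) ∧
        ε ^ 2 / 2 ^ (d + 1) * (#(cube d M) : ℝ) ^ 2 ≤
          ‖∑ a ∈ cube d M, ∑ b ∈ cube d M, g' b * χ (Δ_[h] F (a - b))‖ := by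
  set B : ℝ := ((#(cube d M) : ℕ) : ℝ) with hB
  have hB0 : 0 < B := Nat.cast_pos.2 (card_cube_pos d M)
  set G : (Fin d → ℤ) → (Fin d → ℤ) → ℂ := fun h b =>
    if b - h ∈ cube d M then g (b - h) * starRingEnd ℂ (g b) else 0 with hG
  have hG1 : ∀ h b, ‖G h b‖ ≤ 1 := by
    intro h b
    simp only [hG]
    split_ifs
    · rw [norm_mul, RCLike.norm_conj]
      exact mul_le_one₀ (hg _) (norm_nonneg _) (hg _)
    · simp
  set T : (Fin d → ℤ) → ℝ := fun h =>
    ‖∑ a ∈ cube d M, ∑ b ∈ cube d M, G h b * χ (Δ_[h] F (a - b))‖ with hT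
  have hCS := sq_norm_sum_sum_char_le M F χ f g hf
  have hsum : ε ^ 2 * B ^ 3 ≤ ∑ h ∈ cube d (2 * M), T h := by
    have h1 : (ε * B ^ 2) ^ 2 ≤ B * ∑ h ∈ cube d (2 * M), T h :=
      (pow_le_pow_left₀ (by positivity) hlarge 2).trans hCS
    refine le_of_mul_le_mul_left ?_ hB0
    linarith
  have hcard : (#(cube d (2 * M)) : ℝ) ≤ 2 ^ d * B := by
    rw [hB]
    exact_mod_cast card_cube_mul_le d M 2 (by norm_num)
  refine ⟨{h ∈ cube d (2 * M) | ε ^ 2 / 2 ^ (d + 1) * B ^ 2 ≤ T h}, filter_subset _ _, ?_, ?_⟩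
  · have h1 := exists_many_large (cube d (2 * M)) T (ε ^ 2 / 2 ^ (d + 1) * B ^ 2)
      (ε ^ 2 * B ^ 3) (B ^ 2) (fun h _ => norm_sum_sum_char_le M _ χ (G h) (hG1 h))
      (by positivity) hsum
    have h2 : ε ^ 2 / 2 ^ (d + 1) * B ^ 2 * #(cube d (2 * M)) ≤ ε ^ 2 / 2 * B ^ 3 := by
      calc _ ≤ ε ^ 2 / 2 ^ (d + 1) * B ^ 2 * (2 ^ d * B) := by gcongr
        _ = _ := by field_simp; ring
    refine le_of_mul_le_mul_right ?_ (show 0 < B ^ 2 by positivity)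
    linarith
  · intro h hh
    exact ⟨G h, hG1 h, (mem_filter.1 hh).2⟩

theorem exists_card_cube_sub_le (d W : ℕ) {κ : ℝ} (hκ : 0 < κ) :
    ∃ M₀ : ℕ, ∀ M ≥ M₀, (#(cube d (M + W)) : ℝ) - #(cube d M) ≤ κ * #(cube d M) := by
  have h1 : Tendsto (fun M : ℕ => (1 + 2 * W / (2 * (M : ℝ) + 1)) ^ d) atTop
      (nhds ((1 + 0) ^ d)) := by
    refine Tendsto.pow (tendsto_const_nhds.add (Tendsto.const_div_atTop ?_ _)) d
    exact tendsto_atTop_add_const_right _ _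
      (tendsto_natCast_atTop_atTop.const_mul_atTop two_pos)
  obtain ⟨M₀, hM₀⟩ := eventually_atTop.1
    (h1.eventually (gt_mem_nhds (show ((1 : ℝ) + 0) ^ d < 1 + κ by simpa using hκ)))
  refine ⟨M₀, fun M hM => ?_⟩
  have h2 := hM₀ M hM
  have h3 : (2 * ((M : ℝ) + W) + 1) = (1 + 2 * W / (2 * (M : ℝ) + 1)) * (2 * M + 1) := by
    field_simp
    ring
  rw [card_cube, card_cube]
  push_cast
  rw [h3, mul_pow, ← sub_one_mul]
  refine mul_le_mul_of_nonneg_right ?_ (by positivity)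
  linarith

theorem phaseDist_fwdDiff_le_of_large {A : Type*} [AddCommGroup A] {d M W : ℕ} {κ ε : ℝ}
    (hε : 0 < ε)
    (hM : (#(cube d (M + W)) : ℝ) - #(cube d M) ≤ κ * #(cube d M)) {F : (Fin d → ℤ) → A}
    (hF : IsPolyMap 1 F) {χ : AddChar A Circle} {g : (Fin d → ℤ) → ℂ} (hg : ∀ b, ‖g b‖ ≤ 1)
    (hlarge : ε * (#(cube d M) : ℝ) ^ 2 ≤
      ‖∑ a ∈ cube d M, ∑ b ∈ cube d M, g b * χ (F (a - b))‖) {v : Fin d → ℤ}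
    (hv : v ∈ cube d W) :
    phaseDist χ (Δ_[v] F 0) ≤ 2 * κ / ε := by
  set B : ℝ := ((#(cube d M) : ℕ) : ℝ) with hB
  have hB0 : 0 < B := Nat.cast_pos.2 (card_cube_pos d M)
  have hsubset : cube d M ⊆ cube d (M + W) := cube_mono (by omega)
  have hdiff : (#(cube d (M + W) \ cube d M) : ℝ) ≤ κ * B := by
    rw [card_sdiff_of_subset hsubset, Nat.cast_sub (card_le_card hsubset)]
    exact hM
  have hinner : ∀ b, phaseDist χ (Δ_[v] F 0) * ‖∑ a ∈ cube d M, (χ (F (a - b)) : ℂ)‖ ≤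
      2 * κ * B := by
    intro b
    have hshift : ∀ a, (χ (Δ_[v] F 0) : ℂ) * χ (F (a - b)) = χ (F (a + v - b)) := by
      intro a
      have h := hF.fwdDiff_iter_eq v 0 (a - b)
      simp only [Function.iterate_one] at h
      rw [h, ← Circle.coe_mul, ← AddChar.map_add_eq_mul, fwdDiff, sub_add_cancel,
        sub_add_eq_add_sub]
    have h1 : ((χ (Δ_[v] F 0) : ℂ) - 1) * ∑ a ∈ cube d M, (χ (F (a - b)) : ℂ) =
        ∑ a ∈ (cube d M).map (addRightEmbedding v), (χ (F (a - b)) : ℂ) -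
          ∑ a ∈ cube d M, (χ (F (a - b)) : ℂ) := by
      rw [sub_mul, one_mul, mul_sum, sum_map]
      simp only [hshift, addRightEmbedding_apply]
    have hmap : (cube d M).map (addRightEmbedding v) ⊆ cube d (M + W) := by
      intro x hx
      obtain ⟨a, ha, rfl⟩ := mem_map.1 hx
      exact add_mem_cube ha hv
    have h2 : ∀ S ⊆ cube d (M + W), #S = #(cube d M) →
        ‖∑ a ∈ cube d (M + W), (χ (F (a - b)) : ℂ) - ∑ a ∈ S, (χ (F (a - b)) : ℂ)‖ ≤ κ * B := by
      intro S hS hcard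
      rw [← sum_sdiff_eq_sub hS]
      refine (norm_sum_le_of_le _ (n := fun _ => (1 : ℝ)) fun a _ => (Circle.norm_coe _).le).trans ?_
      rw [sum_const, nsmul_eq_mul, mul_one, card_sdiff_of_subset hS,
        Nat.cast_sub (card_le_card hS), hcard]
      exact hM
    rw [phaseDist, ← norm_mul, h1]
    have h3 := h2 _ hmap (card_map _)
    have h4 := h2 _ hsubset rfl
    rw [norm_sub_rev] at h3
    have h5 := norm_add_le_of_le h3 h4
    rw [sub_add_sub_cancel] at h5
    linarith
  have h6 : phaseDist χ (Δ_[v] F 0) *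
      ‖∑ a ∈ cube d M, ∑ b ∈ cube d M, g b * χ (F (a - b))‖ ≤ B * (2 * κ * B) := by
    rw [sum_comm]
    simp only [← mul_sum]
    calc _ ≤ phaseDist χ (Δ_[v] F 0) *
          ∑ b ∈ cube d M, ‖∑ a ∈ cube d M, (χ (F (a - b)) : ℂ)‖ := by
            refine mul_le_mul_of_nonneg_left (norm_sum_le_of_le _ fun b _ => ?_)
              (phaseDist_nonneg _ _)
            rw [norm_mul]
            exact mul_le_of_le_one_left (norm_nonneg _) (hg b)
      _ ≤ ∑ b ∈ cube d M, 2 * κ * B := by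
            rw [mul_sum]
            exact sum_le_sum fun b _ => hinner b
      _ = _ := by rw [sum_const, nsmul_eq_mul]
  have h7 : phaseDist χ (Δ_[v] F 0) * (ε * B ^ 2) ≤ B * (2 * κ * B) :=
    (mul_le_mul_of_nonneg_left hlarge (phaseDist_nonneg _ _)).trans h6
  rw [le_div_iff₀ hε]
  refine le_of_mul_le_mul_right ?_ (show 0 < B ^ 2 by positivity)
  linarith

theorem phaseDist_fwdDiff_iter_succ_le {A : Type*} [AddCommGroup A] {d M W C Q s : ℕ} {c η : ℝ}
    (hC : 3 ^ d < C * c) (hM : C * W ≤ M) {F : (Fin d → ℤ) → A} (hF : IsPolyMap (s + 1) F)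
    {χ : AddChar A Circle} {S : Finset (Fin d → ℤ)} (hS : S ⊆ cube d (2 * M))
    (hcard : c * #(cube d M) ≤ #S) {v : Fin d → ℤ} (hv : v ∈ cube d W)
    (hη : ∀ h ∈ S, phaseDist χ (Q • (Δ_[v])^[s] (Δ_[h] F) 0) ≤ η) :
    phaseDist χ ((C.factorial * Q) • (Δ_[v])^[s + 1] F 0) ≤ C.factorial * (2 * η) := by
  have hB0 : (0 : ℝ) < #(cube d M) := by exact_mod_cast card_cube_pos d M
  obtain ⟨x, hx, q, hq0, hqC, hxq⟩ := exists_add_nsmul_mem S (cube d (3 * M)) v C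
    (by
      intro x hx j hj
      have h1 : x + j • v ∈ cube d (2 * M + j * W) := add_mem_cube (hS hx) (nsmul_mem_cube hv j)
      refine cube_mono ?_ h1
      have : j * W ≤ C * W := Nat.mul_le_mul_right _ hj.le
      omega)
    (by
      have h1 : (#(cube d (3 * M)) : ℝ) ≤ 3 ^ d * #(cube d M) := by
        exact_mod_cast card_cube_mul_le d M 3 (by norm_num)
      have h2 : (#(cube d (3 * M)) : ℝ) < C * #S := by
        calc _ ≤ (3 : ℝ) ^ d * #(cube d M) := h1
          _ < C * c * #(cube d M) := by gcongr
          _ = C * (c * #(cube d M)) := by ring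
          _ ≤ _ := by gcongr
      exact_mod_cast h2)
  have h1 := phaseDist_sub_le χ (Q • (Δ_[v])^[s] (Δ_[x + q • v] F) 0)
    (Q • (Δ_[v])^[s] (Δ_[x] F) 0)
  have h2 : Q • (Δ_[v])^[s] (Δ_[x + q • v] F) 0 - Q • (Δ_[v])^[s] (Δ_[x] F) 0 =
      (q * Q) • (Δ_[v])^[s + 1] F 0 := by
    rw [← smul_sub, fwdDiff_iter_fwdDiff_apply, fwdDiff_iter_fwdDiff_apply, sub_sub_sub_cancel_right,
      zero_add, zero_add, hF.fwdDiff_iter_add_nsmul, smul_smul, mul_comm]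
  rw [h2] at h1
  have h3 : phaseDist χ ((q * Q) • (Δ_[v])^[s + 1] F 0) ≤ 2 * η := by
    linarith [hη _ hx, hη _ hxq]
  obtain ⟨r, hr⟩ := Nat.dvd_factorial hq0 hqC.le
  have h4 : (C.factorial * Q) • (Δ_[v])^[s + 1] F 0 = r • ((q * Q) • (Δ_[v])^[s + 1] F 0) := by
    rw [smul_smul, hr]; congr 1; ring
  have hη0 : 0 ≤ 2 * η := (phaseDist_nonneg _ _).trans h3
  have h5 : (r : ℝ) ≤ C.factorial := by
    exact_mod_cast Nat.le_of_dvd C.factorial_pos ⟨q, by rw [hr, mul_comm]⟩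
  rw [h4]
  calc _ ≤ r * phaseDist χ ((q * Q) • (Δ_[v])^[s + 1] F 0) := phaseDist_nsmul_le _ _ _
    _ ≤ r * (2 * η) := by gcongr
    _ ≤ _ := by gcongr

/-- A soft form of Weyl's inequality: if an exponential sum over a box along a polynomial map of
degree `s`, with a weight depending on `b` alone, is large, then the leading coefficients of the
phase are close to rationals of bounded denominator. -/
theorem weyl_one_weight (A : Type*) [AddCommGroup A] (d s : ℕ) {ε : ℝ} (hε : 0 < ε) :
    ∃ Q : ℕ, 0 < Q ∧ ∀ (W : ℕ) (η : ℝ), 0 < η → ∃ M₀ : ℕ, ∀ M ≥ M₀, ∀ F : (Fin d → ℤ) → A,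
      IsPolyMap (s + 1) F → ∀ (χ : AddChar A Circle) (g : (Fin d → ℤ) → ℂ), (∀ b, ‖g b‖ ≤ 1) →
      ε * (#(cube d M) : ℝ) ^ 2 ≤ ‖∑ a ∈ cube d M, ∑ b ∈ cube d M, g b * χ (F (a - b))‖ →
      ∀ v ∈ cube d W, phaseDist χ (Q • (Δ_[v])^[s + 1] F 0) ≤ η := by
  induction s generalizing ε with
  | zero =>
    refine ⟨1, one_pos, fun W η hη => ?_⟩
    obtain ⟨M₀, hM₀⟩ := exists_card_cube_sub_le d W (κ := ε * η / 2) (by positivity)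
    refine ⟨M₀, fun M hM F hF χ g hg hlarge v hv => ?_⟩
    have h := phaseDist_fwdDiff_le_of_large hε (hM₀ M hM) hF hg hlarge hv
    rw [one_smul]
    refine h.trans (le_of_eq ?_)
    field_simp
  | succ s ih =>
    obtain ⟨Q, hQ, hweyl⟩ := ih (ε := ε ^ 2 / 2 ^ (d + 1)) (by positivity)
    obtain ⟨C, hC⟩ := exists_nat_gt ((3 : ℝ) ^ d / (ε ^ 2 / 2))
    rw [div_lt_iff₀ (by positivity)] at hC
    refine ⟨C.factorial * Q, Nat.mul_pos C.factorial_pos hQ, fun W η hη => ?_⟩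
    have hf : (0 : ℝ) < C.factorial := by exact_mod_cast C.factorial_pos
    obtain ⟨M₀, hM₀⟩ := hweyl W (η / (2 * C.factorial)) (by positivity)
    refine ⟨max M₀ (C * W), fun M hM F hF χ g hg hlarge v hv => ?_⟩
    obtain ⟨S, hS, hcard, hdiff⟩ := exists_many_differences (f := fun _ => 1) (by simp) hg hε
      (by simpa using hlarge)
    refine (phaseDist_fwdDiff_iter_succ_le (η := η / (2 * C.factorial)) hC
      (le_of_max_le_right hM) hF hS hcard hv fun h hh => ?_).trans (le_of_eq (by field_simp))
    obtain ⟨g', hg', hlarge'⟩ := hdiff h hh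
    exact hM₀ M (le_of_max_le_left hM) _ (hF h) χ g' hg' hlarge' v hv

/-- The soft form of Weyl's inequality for arbitrary bounded weights and degree at least two. -/
theorem weyl_two_weights (A : Type*) [AddCommGroup A] (d s : ℕ) {ε : ℝ} (hε : 0 < ε) :
    ∃ Q : ℕ, 0 < Q ∧ ∀ (W : ℕ) (η : ℝ), 0 < η → ∃ M₀ : ℕ, ∀ M ≥ M₀, ∀ F : (Fin d → ℤ) → A,
      IsPolyMap (s + 2) F → ∀ (χ : AddChar A Circle) (f g : (Fin d → ℤ) → ℂ),
      (∀ a, ‖f a‖ ≤ 1) → (∀ b, ‖g b‖ ≤ 1) →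
      ε * (#(cube d M) : ℝ) ^ 2 ≤ ‖∑ a ∈ cube d M, ∑ b ∈ cube d M, f a * g b * χ (F (a - b))‖ →
      ∀ v ∈ cube d W, phaseDist χ (Q • (Δ_[v])^[s + 2] F 0) ≤ η := by
  obtain ⟨Q, hQ, hweyl⟩ := weyl_one_weight A d s (ε := ε ^ 2 / 2 ^ (d + 1)) (by positivity)
  obtain ⟨C, hC⟩ := exists_nat_gt ((3 : ℝ) ^ d / (ε ^ 2 / 2))
  rw [div_lt_iff₀ (by positivity)] at hC
  refine ⟨C.factorial * Q, Nat.mul_pos C.factorial_pos hQ, fun W η hη => ?_⟩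
  have hf : (0 : ℝ) < C.factorial := by exact_mod_cast C.factorial_pos
  obtain ⟨M₀, hM₀⟩ := hweyl W (η / (2 * C.factorial)) (by positivity)
  refine ⟨max M₀ (C * W), fun M hM F hF χ f g hf hg hlarge v hv => ?_⟩
  obtain ⟨S, hS, hcard, hdiff⟩ := exists_many_differences hf hg hε hlarge
  refine (phaseDist_fwdDiff_iter_succ_le (η := η / (2 * C.factorial)) hC
    (le_of_max_le_right hM) hF hS hcard hv fun h hh => ?_).trans (le_of_eq (by field_simp))
  obtain ⟨g', hg', hlarge'⟩ := hdiff h hh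
  exact hM₀ M (le_of_max_le_left hM) _ (hF h) χ g' hg' hlarge' v hv

section IsPolyMap

variable {V A : Type*} [AddCommGroup V] [AddCommGroup A]

theorem isPolyMap_zero (s : ℕ) : IsPolyMap s (0 : V → A) := by
  induction s with
  | zero =>
    intro h
    ext x
    simp [fwdDiff]
  | succ s ih =>
    intro h
    have : Δ_[h] (0 : V → A) = 0 := by
      ext x
      simp [fwdDiff]
    rwa [this]

theorem IsPolyMap.mono {r s : ℕ} {F : V → A} (hF : IsPolyMap r F) (hrs : r ≤ s) :
    IsPolyMap s F := by
  induction r generalizing s F with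
  | zero =>
    cases s with
    | zero => exact hF
    | succ s => exact fun h => (hF h).symm ▸ isPolyMap_zero s
  | succ r ih =>
    cases s with
    | zero => omega
    | succ s => exact fun h => ih (hF h) (by omega)

theorem IsPolyMap.add {s : ℕ} {F G : V → A} (hF : IsPolyMap s F) (hG : IsPolyMap s G) :
    IsPolyMap s (F + G) := by
  induction s generalizing F G with
  | zero => exact fun h => by rw [fwdDiff_add, hF h, hG h, add_zero]
  | succ s ih => exact fun h => by rw [fwdDiff_add]; exact ih (hF h) (hG h)

theorem IsPolyMap.sum {ι : Type*} {s : ℕ} (S : Finset ι) {F : ι → V → A}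
    (hF : ∀ i ∈ S, IsPolyMap s (F i)) : IsPolyMap s (∑ i ∈ S, F i) :=
  Finset.sum_induction F (IsPolyMap s) (fun _ _ => IsPolyMap.add) (isPolyMap_zero s) hF

theorem IsPolyMap.const_smul {s : ℕ} {F : V → A} (n : ℕ) (hF : IsPolyMap s F) :
    IsPolyMap s (n • F) := by
  induction s generalizing F with
  | zero => exact fun h => by rw [fwdDiff_const_smul, hF h, smul_zero]
  | succ s ih => exact fun h => by rw [fwdDiff_const_smul]; exact ih (hF h)

theorem IsPolyMap.comp_add_right {s : ℕ} {F : V → A} (hF : IsPolyMap s F) (w : V) :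
    IsPolyMap s fun x => F (x + w) := by
  have key : ∀ (F : V → A) h, Δ_[h] (fun x => F (x + w)) = fun x => (Δ_[h] F) (x + w) := by
    intro F h
    ext x
    simp only [fwdDiff, add_right_comm]
  induction s generalizing F with
  | zero => exact fun h => by rw [key, hF h]; rfl
  | succ s ih => exact fun h => by rw [key]; exact ih (hF h)

theorem IsPolyMap.fwdDiff_eq_zero_or {s : ℕ} {F : V → A} (hF : IsPolyMap s F) (h : V) :
    Δ_[h] F = 0 ∨ ∃ s', s = s' + 1 ∧ IsPolyMap s' (Δ_[h] F) := by
  cases s with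
  | zero => exact Or.inl (hF h)
  | succ s => exact Or.inr ⟨s, rfl, hF h⟩

theorem IsPolyMap.mul {r s : ℕ} {f g : V → ℤ} (hf : IsPolyMap r f) (hg : IsPolyMap s g) :
    IsPolyMap (r + s) (f * g) := by
  have key : ∀ (f g : V → ℤ) h, Δ_[h] (f * g) =
      Δ_[h] f * (fun x => g (x + h)) + f * Δ_[h] g := by
    intro f g h
    ext x
    simp only [fwdDiff, Pi.mul_apply, Pi.add_apply]
    ring
  induction hn : r + s generalizing r s f g with
  | zero =>
    intro h
    obtain ⟨rfl, rfl⟩ : r = 0 ∧ s = 0 := by omega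
    rw [key, hf h, hg h, zero_mul, mul_zero, add_zero]
  | succ n ih =>
    intro h
    rw [key]
    refine IsPolyMap.add ?_ ?_
    · rcases hf.fwdDiff_eq_zero_or h with h0 | ⟨r', rfl, hr'⟩
      · rw [h0, zero_mul]
        exact isPolyMap_zero n
      · exact ih hr' (hg.comp_add_right h) (by omega)
    · rcases hg.fwdDiff_eq_zero_or h with h0 | ⟨s', rfl, hs'⟩
      · rw [h0, mul_zero]
        exact isPolyMap_zero n
      · exact ih hf hs' (by omega)

theorem isPolyMap_const (a : A) : IsPolyMap 0 fun _ : V => a := by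
  intro h
  ext x
  simp [fwdDiff]

theorem isPolyMap_pi {ι : Type*} {s : ℕ} {F : V → ι → A}
    (hF : ∀ i, IsPolyMap s fun x => F x i) : IsPolyMap s F := by
  induction s generalizing F with
  | zero =>
    intro h
    ext x i
    exact congrFun (hF i h) x
  | succ s ih => exact fun h => ih fun i => hF i h

end IsPolyMap

theorem isPolyMap_coord {d : ℕ} (i : Fin d) : IsPolyMap 1 fun x : Fin d → ℤ => x i := by
  intro h h'
  ext x
  simp [fwdDiff]

theorem isPolyMap_prod_pow {d : ℕ} (u : Fin d →₀ ℕ) :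
    IsPolyMap (∑ i, u i) fun x : Fin d → ℤ => ∏ i, x i ^ u i := by
  have hpow : ∀ (i : Fin d) (n : ℕ), IsPolyMap n fun x : Fin d → ℤ => x i ^ n := by
    intro i n
    induction n with
    | zero => simpa using isPolyMap_const (V := Fin d → ℤ) (1 : ℤ)
    | succ n ih =>
      simp only [pow_succ]
      exact ih.mul (isPolyMap_coord i)
  have key : ∀ S : Finset (Fin d),
      IsPolyMap (∑ i ∈ S, u i) fun x : Fin d → ℤ => ∏ i ∈ S, x i ^ u i := by
    intro S
    induction S using Finset.induction_on with
    | empty => simpa using isPolyMap_const (V := Fin d → ℤ) (1 : ℤ)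
    | insert i S hi ih =>
      simp only [prod_insert hi, sum_insert hi]
      exact (hpow i (u i)).mul ih
  exact key univ

theorem MvPolynomial.IsHomogeneous.isPolyMap {d n : ℕ} {f : MvPolynomial (Fin d) ℤ}
    (hf : f.IsHomogeneous n) : IsPolyMap n fun x => MvPolynomial.eval x f := by
  have h : (fun x => MvPolynomial.eval x f) =
      ∑ u ∈ f.support, (fun _ => f.coeff u) * fun x : Fin d → ℤ => ∏ i, x i ^ u i := by
    ext x
    simp [MvPolynomial.eval_eq']
  rw [h]
  refine IsPolyMap.sum _ fun u hu => ?_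
  have hdeg : ∑ i, u i = n := by
    have h1 := hf (MvPolynomial.mem_support_iff.1 hu)
    rw [← Finsupp.degree_eq_sum, Finsupp.degree_eq_weight_one]
    exact h1
  have h2 := (isPolyMap_const (V := Fin d → ℤ) (f.coeff u)).mul (isPolyMap_prod_pow u)
  rwa [hdeg, zero_add] at h2

theorem MvPolynomial.IsHomogeneous.eval_nsmul {d n : ℕ} {f : MvPolynomial (Fin d) ℤ}
    (hf : f.IsHomogeneous n) (k : ℕ) (x : Fin d → ℤ) :
    MvPolynomial.eval (k • x) f = k ^ n * MvPolynomial.eval x f := by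
  rw [MvPolynomial.eval_eq', MvPolynomial.eval_eq', mul_sum]
  refine sum_congr rfl fun u hu => ?_
  have hdeg : ∑ i, u i = n := by
    have h1 := hf (MvPolynomial.mem_support_iff.1 hu)
    rw [← Finsupp.degree_eq_sum, Finsupp.degree_eq_weight_one]
    exact h1
  simp only [Pi.smul_apply, nsmul_eq_mul, mul_pow, prod_mul_distrib, prod_pow_eq_pow_sum, hdeg]
  ring

/-- The homogeneous component of degree `s` of a polynomial map. -/
noncomputable def homComp {d : ℕ} (p : Fin d → MvPolynomial (Fin d) ℤ) (s : ℕ)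
    (v : Fin d → ℤ) : Fin d → ℤ :=
  fun i => MvPolynomial.eval v (MvPolynomial.homogeneousComponent s (p i))

theorem homComp_nsmul {d : ℕ} (p : Fin d → MvPolynomial (Fin d) ℤ) (s k : ℕ) (v : Fin d → ℤ) :
    homComp p s (k • v) = k ^ s • homComp p s v := by
  ext i
  refine ((MvPolynomial.homogeneousComponent_isHomogeneous s (p i)).eval_nsmul k v).trans ?_
  simp [homComp]

theorem isPolyMap_homComp {d : ℕ} (p : Fin d → MvPolynomial (Fin d) ℤ) (s : ℕ) :
    IsPolyMap s (homComp p s) :=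
  isPolyMap_pi fun i => (MvPolynomial.homogeneousComponent_isHomogeneous s (p i)).isPolyMap

theorem homComp_zero {d : ℕ} {p : Fin d → MvPolynomial (Fin d) ℤ}
    (hp0 : ∀ i, MvPolynomial.constantCoeff (p i) = 0) (v : Fin d → ℤ) : homComp p 0 v = 0 := by
  ext i
  have := hp0 i
  rw [MvPolynomial.constantCoeff_eq] at this
  simp [homComp, this]

theorem sum_homComp {d D : ℕ} {p : Fin d → MvPolynomial (Fin d) ℤ}
    (hD : ∀ i, (p i).totalDegree ≤ D) (v : Fin d → ℤ) :
    ∑ s ∈ range (D + 1), homComp p s v = fun i => MvPolynomial.eval v (p i) := by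
  ext i
  conv_rhs => rw [← MvPolynomial.sum_homogeneousComponent (p i), map_sum]
  rw [Finset.sum_apply]
  refine (sum_subset (range_mono (by simpa using hD i)) fun s _ hs => ?_).symm
  rw [mem_range, not_lt] at hs
  rw [homComp, MvPolynomial.homogeneousComponent_eq_zero _ _ (by omega), map_zero]

theorem fwdDiff_iter_homComp {d : ℕ} (p : Fin d → MvPolynomial (Fin d) ℤ) (n r : ℕ)
    (v : Fin d → ℤ) :
    (Δ_[v])^[n] (homComp p r) 0 = ((Δ_[1])^[n] (fun x : ℤ => x ^ r) 0) • homComp p r v := by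
  rw [fwdDiff_iter_eq_sum_shift, fwdDiff_iter_eq_sum_shift, sum_smul]
  refine sum_congr rfl fun k _ => ?_
  rw [zero_add, homComp_nsmul, ← natCast_zsmul, smul_smul]
  simp

/-- The part of degree at most `s` of the polynomial map `y ↦ P(K y)`. -/
noncomputable def truncComp {d : ℕ} (p : Fin d → MvPolynomial (Fin d) ℤ) (s K : ℕ)
    (v : Fin d → ℤ) : Fin d → ℤ :=
  ∑ r ∈ range (s + 1), homComp p r (K • v)

theorem truncComp_eq {d : ℕ} (p : Fin d → MvPolynomial (Fin d) ℤ) (s K : ℕ) :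
    truncComp p s K = ∑ r ∈ range (s + 1), K ^ r • homComp p r := by
  ext1 v
  simp only [truncComp, homComp_nsmul, Finset.sum_apply, Pi.smul_apply]

theorem isPolyMap_truncComp {d : ℕ} (p : Fin d → MvPolynomial (Fin d) ℤ) (s K : ℕ) :
    IsPolyMap s (truncComp p s K) := by
  rw [truncComp_eq]
  refine IsPolyMap.sum _ fun r hr => IsPolyMap.const_smul _ ?_
  exact (isPolyMap_homComp p r).mono (by simpa [Nat.lt_succ_iff] using hr)

theorem fwdDiff_iter_truncComp {d : ℕ} (p : Fin d → MvPolynomial (Fin d) ℤ) (s K : ℕ)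
    (v : Fin d → ℤ) :
    (Δ_[v])^[s] (truncComp p s K) 0 = (s.factorial * K ^ s) • homComp p s v := by
  rw [truncComp_eq, fwdDiff_iter_finsetSum, Finset.sum_apply, sum_range_succ, sum_eq_zero]
  · rw [fwdDiff_iter_const_smul, Pi.smul_apply, fwdDiff_iter_homComp, fwdDiff_iter_eq_factorial,
      zero_add, mul_comm, mul_smul]
    simp
  · intro r hr
    rw [fwdDiff_iter_const_smul, Pi.smul_apply, fwdDiff_iter_homComp,
      fwdDiff_iter_pow_eq_zero_of_lt (mem_range.1 hr)]
    simp

theorem MvPolynomial.homogeneousComponent_map {σ R S : Type*} [CommSemiring R] [CommSemiring S]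
    (f : R →+* S) (n : ℕ) (p : MvPolynomial σ R) :
    MvPolynomial.homogeneousComponent n (p.map f) =
      (MvPolynomial.homogeneousComponent n p).map f := by
  classical
  ext u
  simp only [MvPolynomial.coeff_homogeneousComponent, MvPolynomial.coeff_map]
  split_ifs <;> simp

/-- Values of the homogeneous components of degree between `2` and `D` of a polynomial map. -/
def homValues {d : ℕ} (p : Fin d → MvPolynomial (Fin d) ℤ) (D : ℕ) : Set (Fin d → ℤ) :=
  {w | ∃ s v, 2 ≤ s ∧ s ≤ D ∧ homComp p s v = w}

/-- Coordinatewise inclusion of integer vectors into rational vectors. -/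
def ratCast (d : ℕ) : (Fin d → ℤ) →+ (Fin d → ℚ) :=
  (Int.castAddHom ℚ).compLeft (Fin d)

theorem ratCast_injective (d : ℕ) : Function.Injective (ratCast d) := fun v w h => by
  ext i
  exact Int.cast_injective (α := ℚ) (congrFun h i)

theorem eval_homogeneousComponent_sum {d : ℕ} (p : Fin d → MvPolynomial (Fin d) ℤ)
    (a : Fin d → ℚ) (s : ℕ) (v : Fin d → ℤ) :
    MvPolynomial.eval (ratCast d v) (MvPolynomial.homogeneousComponent s
      (∑ i, a i • (p i).map (Int.castRingHom ℚ))) = ∑ i, a i * (homComp p s v i : ℚ) := by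
  rw [map_sum, map_sum]
  refine sum_congr rfl fun i _ => ?_
  rw [map_smul, MvPolynomial.homogeneousComponent_map, MvPolynomial.smul_eval,
    MvPolynomial.eval_map]
  congr 1
  exact (MvPolynomial.eval₂_comp (Int.castRingHom ℚ) v _).symm

theorem span_homValues_eq_top {d D : ℕ} {p : Fin d → MvPolynomial (Fin d) ℤ}
    (hdeg : ∀ a : Fin d → ℚ, a ≠ 0 →
      2 ≤ (∑ i, a i • (p i).map (Int.castRingHom ℚ)).totalDegree)
    (hD : ∀ i, (p i).totalDegree ≤ D) :
    Submodule.span ℚ (ratCast d '' homValues p D) = ⊤ := by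
  by_contra hne
  obtain ⟨f, hf0, hf⟩ := Submodule.exists_le_ker_of_lt_top _ (lt_top_iff_ne_top.2 hne)
  set a : Fin d → ℚ := fun i => f (Pi.single i 1) with ha
  have hfa : ∀ x, f x = ∑ i, a i * x i := by
    intro x
    conv_lhs => rw [pi_eq_sum_univ' x, map_sum]
    refine sum_congr rfl fun i _ => ?_
    rw [map_smul, smul_eq_mul, mul_comm]
  have ha0 : a ≠ 0 := by
    rintro h
    refine hf0 (LinearMap.ext fun x => ?_)
    simp [hfa, h]
  have h2 := hdeg a ha0
  set q := ∑ i, a i • (p i).map (Int.castRingHom ℚ) with hq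
  have hcomp : ∀ s, 2 ≤ s → MvPolynomial.homogeneousComponent s q = 0 := by
    intro s hs
    refine MvPolynomial.funext_set (fun _ => Set.range ((↑) : ℤ → ℚ))
      (fun _ => Set.infinite_range_of_injective Int.cast_injective) fun x hx => ?_
    choose v hv using fun i => hx i (Set.mem_univ i)
    obtain rfl : ratCast d v = x := funext hv
    rw [eval_homogeneousComponent_sum, map_zero]
    by_cases hsD : s ≤ D
    · have := hf (Submodule.subset_span ⟨_, ⟨s, v, hs, hsD, rfl⟩, rfl⟩)
      rw [LinearMap.mem_ker, hfa] at this
      exact this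
    · refine sum_eq_zero fun i _ => ?_
      rw [homComp, MvPolynomial.homogeneousComponent_eq_zero _ _ (by have := hD i; omega)]
      simp
  have : q.totalDegree ≤ 1 := by
    refine Finset.sup_le fun u hu => ?_
    by_contra hlt
    rw [not_le] at hlt
    have h1 := congrArg (MvPolynomial.coeff u) (hcomp _ hlt)
    rw [MvPolynomial.coeff_homogeneousComponent, if_pos (by rfl),
      MvPolynomial.coeff_zero] at h1
    exact MvPolynomial.mem_support_iff.1 hu h1
  omega

theorem exists_nsmul_mem_closure_of_mem_span {d : ℕ} {S : Set (Fin d → ℤ)} {x : Fin d → ℚ}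
    (hx : x ∈ Submodule.span ℚ (ratCast d '' S)) :
    ∃ n : ℕ, 0 < n ∧ ∃ z ∈ AddSubgroup.closure S, n • x = ratCast d z := by
  induction hx using Submodule.span_induction with
  | mem x hx =>
    obtain ⟨z, hz, rfl⟩ := hx
    exact ⟨1, one_pos, z, AddSubgroup.subset_closure hz, one_smul _ _⟩
  | zero => exact ⟨1, one_pos, 0, zero_mem _, by simp⟩
  | add x y _ _ hx hy =>
    obtain ⟨m, hm, z, hz, hxz⟩ := hx
    obtain ⟨n, hn, w, hw, hyw⟩ := hy
    refine ⟨m * n, Nat.mul_pos hm hn, n • z + m • w,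
      add_mem (nsmul_mem hz n) (nsmul_mem hw m), ?_⟩
    rw [map_add, map_nsmul, map_nsmul, ← hxz, ← hyw, smul_add, smul_smul, smul_smul,
      mul_comm n m]
  | smul a x _ hx =>
    obtain ⟨m, hm, z, hz, hxz⟩ := hx
    refine ⟨a.den * m, Nat.mul_pos a.den_pos hm, a.num • z, zsmul_mem hz _, ?_⟩
    rw [map_zsmul, ← hxz]
    ext i
    have := Rat.den_mul_eq_num a
    simp only [Pi.smul_apply, mul_smul]
    simp only [nsmul_eq_mul, zsmul_eq_mul, smul_eq_mul]
    linear_combination (m * x i) * this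

theorem exists_forall_nsmul_single_mem_closure {d D : ℕ} {p : Fin d → MvPolynomial (Fin d) ℤ}
    (hdeg : ∀ a : Fin d → ℚ, a ≠ 0 →
      2 ≤ (∑ i, a i • (p i).map (Int.castRingHom ℚ)).totalDegree)
    (hD : ∀ i, (p i).totalDegree ≤ D) :
    ∃ n : ℕ, 0 < n ∧ ∀ x : Fin d → ℤ, n • x ∈ AddSubgroup.closure (homValues p D) := by
  have h : ∀ l : Fin d, ∃ n : ℕ, 0 < n ∧
      n • (Pi.single l 1 : Fin d → ℤ) ∈ AddSubgroup.closure (homValues p D) := by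
    intro l
    obtain ⟨n, hn, z, hz, h⟩ := exists_nsmul_mem_closure_of_mem_span (S := homValues p D)
      (x := ratCast d (Pi.single l 1))
      (by rw [span_homValues_eq_top hdeg hD]; exact Submodule.mem_top)
    refine ⟨n, hn, ?_⟩
    rw [← map_nsmul] at h
    rwa [ratCast_injective d h]
  choose n hn h using h
  refine ⟨∏ l, n l, prod_pos fun l _ => hn l, fun x => ?_⟩
  rw [pi_eq_sum_univ' x, smul_sum]
  refine sum_mem fun l _ => ?_
  obtain ⟨c, hc⟩ := dvd_prod_of_mem n (mem_univ l)
  rw [hc, mul_comm, mul_smul, smul_comm (n l)]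
  exact nsmul_mem (zsmul_mem (h l) _) _

theorem phaseDist_le_of_mem_closure {d D : ℕ} {p : Fin d → MvPolynomial (Fin d) ℤ}
    {x : Fin d → ℤ} (hx : x ∈ AddSubgroup.closure (homValues p D)) {η : ℝ} (hη : 0 < η) :
    ∃ W₀ : ℕ, ∀ W ≥ W₀, ∀ χ : AddChar (Fin d → ℤ) Circle,
      (∀ s, 2 ≤ s → s ≤ D → ∀ v ∈ cube d W, phaseDist χ (homComp p s v) ≤ 1 / W) →
      phaseDist χ x ≤ η := by
  induction hx using AddSubgroup.closure_induction generalizing η with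
  | mem x hx =>
    obtain ⟨s, v, hs, hsD, rfl⟩ := hx
    obtain ⟨R, hR⟩ := exists_mem_cube v
    obtain ⟨T, hT⟩ := exists_nat_gt (1 / η)
    refine ⟨max R T, fun W hW χ h => (h s hs hsD v (cube_mono (le_of_max_le_left hW) hR)).trans ?_⟩
    have hTW : (T : ℝ) ≤ W := by exact_mod_cast le_of_max_le_right hW
    have hW0 : (0 : ℝ) < W := (by positivity : (0 : ℝ) < 1 / η).trans (hT.trans_le hTW)
    rw [div_le_comm₀ hW0 hη]
    linarith
  | zero => exact ⟨0, fun W _ χ _ => by simpa using hη.le⟩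
  | add x y _ _ hx hy =>
    obtain ⟨W₁, h₁⟩ := hx (half_pos hη)
    obtain ⟨W₂, h₂⟩ := hy (half_pos hη)
    refine ⟨max W₁ W₂, fun W hW χ h => (phaseDist_add_le χ x y).trans ?_⟩
    linarith [h₁ W (le_of_max_le_left hW) χ h, h₂ W (le_of_max_le_right hW) χ h]
  | neg x _ hx =>
    obtain ⟨W₀, h₀⟩ := hx hη
    exact ⟨W₀, fun W hW χ h => by simpa using h₀ W hW χ h⟩

theorem exists_phaseDist_nsmul_single_le {d D : ℕ} {p : Fin d → MvPolynomial (Fin d) ℤ} {n : ℕ}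
    (hn : ∀ x : Fin d → ℤ, n • x ∈ AddSubgroup.closure (homValues p D)) (S : Finset (Fin d → ℤ))
    {η : ℝ} (hη : 0 < η) :
    ∃ W₀ : ℕ, ∀ W ≥ W₀, ∀ χ : AddChar (Fin d → ℤ) Circle,
      (∀ s, 2 ≤ s → s ≤ D → ∀ v ∈ cube d W, phaseDist χ (homComp p s v) ≤ 1 / W) →
      ∀ x ∈ S, phaseDist χ (n • x) ≤ η := by
  choose W₀ h₀ using fun x => phaseDist_le_of_mem_closure (hn x) hη
  exact ⟨S.sup W₀, fun W hW χ h x hx => h₀ x W ((le_sup hx).trans hW) χ h⟩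

/-- The map `ℤ^d → ℤ^d` with components the given polynomials. -/
noncomputable def evalMap {d : ℕ} (p : Fin d → MvPolynomial (Fin d) ℤ) (v : Fin d → ℤ) :
    Fin d → ℤ :=
  fun i => MvPolynomial.eval v (p i)

theorem evalMap_nsmul_eq {d D : ℕ} {p : Fin d → MvPolynomial (Fin d) ℤ}
    (hD : ∀ i, (p i).totalDegree ≤ D) {s : ℕ} (hs : s ≤ D) (K : ℕ) (v : Fin d → ℤ) :
    evalMap p (K • v) = truncComp p s K v + ∑ r ∈ Ioc s D, K ^ r • homComp p r v := by
  have h : evalMap p (K • v) = ∑ r ∈ range (D + 1), homComp p r (K • v) :=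
    (sum_homComp hD (K • v)).symm
  rw [h, truncComp, ← sum_range_add_sum_Ico _ (by omega : s + 1 ≤ D + 1)]
  congr 1
  refine sum_congr (by ext r; simp only [mem_Ico, mem_Ioc]; omega) fun r _ => ?_
  exact homComp_nsmul p r K v

theorem norm_char_evalMap_sub_char_truncComp_le {d D : ℕ} {p : Fin d → MvPolynomial (Fin d) ℤ}
    (hD : ∀ i, (p i).totalDegree ≤ D) {s : ℕ} (hs : s ≤ D) (hD0 : 0 < D) (K : ℕ)
    (χ : AddChar (Fin d → ℤ) Circle) (v : Fin d → ℤ) {ε : ℝ} (hε : 0 ≤ ε)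
    (h : ∀ r, s < r → r ≤ D → phaseDist χ (K ^ r • homComp p r v) ≤ ε / D) :
    ‖(χ (evalMap p (K • v)) : ℂ) - χ (truncComp p s K v)‖ ≤ ε := by
  have hD' : (0 : ℝ) < D := Nat.cast_pos.2 hD0
  rw [norm_char_sub_char, evalMap_nsmul_eq hD hs, add_sub_cancel_left]
  calc phaseDist χ (∑ r ∈ Ioc s D, K ^ r • homComp p r v)
      ≤ ∑ r ∈ Ioc s D, phaseDist χ (K ^ r • homComp p r v) := phaseDist_sum_le _ _ _
    _ ≤ #(Ioc s D) • (ε / D) := sum_le_card_nsmul _ _ _ fun r hr =>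
        h r (mem_Ioc.1 hr).1 (mem_Ioc.1 hr).2
    _ ≤ D * (ε / D) := by
        rw [nsmul_eq_mul, Nat.card_Ioc]
        gcongr
        omega
    _ = ε := by field_simp

theorem le_norm_sum_truncComp {d D : ℕ} {p : Fin d → MvPolynomial (Fin d) ℤ}
    (hD : ∀ i, (p i).totalDegree ≤ D) {s : ℕ} (hs : s ≤ D) (hD0 : 0 < D) (K M : ℕ)
    (χ : AddChar (Fin d → ℤ) Circle) {A : Finset (Fin d → ℤ)} (hA : A ⊆ cube d M) {ε : ℝ}
    (hε : 0 ≤ ε)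
    (h : ∀ r, s < r → r ≤ D → ∀ v ∈ cube d (2 * M),
      phaseDist χ (K ^ r • homComp p r v) ≤ ε / 2 / D)
    (hlarge : ε * (#(cube d M) : ℝ) ^ 2 ≤
      ‖∑ a ∈ A, ∑ b ∈ A, (χ (evalMap p (K • (a - b))) : ℂ)‖) :
    ε / 2 * (#(cube d M) : ℝ) ^ 2 ≤
      ‖∑ a ∈ A, ∑ b ∈ A, (χ (truncComp p s K (a - b)) : ℂ)‖ := by
  have hdiff : ‖∑ a ∈ A, ∑ b ∈ A, (χ (evalMap p (K • (a - b))) : ℂ) -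
      ∑ a ∈ A, ∑ b ∈ A, (χ (truncComp p s K (a - b)) : ℂ)‖ ≤
      ε / 2 * (#(cube d M) : ℝ) ^ 2 := by
    rw [← sum_sub_distrib]
    simp only [← sum_sub_distrib]
    have hcard : (#A : ℝ) ≤ #(cube d M) := by exact_mod_cast card_le_card hA
    calc _ ≤ ∑ a ∈ A, ∑ b ∈ A, ε / 2 := norm_sum_le_of_le _ fun a ha =>
          norm_sum_le_of_le _ fun b hb =>
            norm_char_evalMap_sub_char_truncComp_le hD hs hD0 K χ _ (by positivity)
              fun r hr hrD => h r hr hrD _ (by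
                rw [two_mul]
                exact sub_mem_cube (hA ha) (hA hb))
      _ = ε / 2 * (#A : ℝ) ^ 2 := by
          simp only [sum_const, nsmul_eq_mul]
          ring
      _ ≤ _ := by gcongr
  have := norm_sub_norm_le (∑ a ∈ A, ∑ b ∈ A, (χ (evalMap p (K • (a - b))) : ℂ))
    (∑ a ∈ A, ∑ b ∈ A, (χ (truncComp p s K (a - b)) : ℂ))
  linarith

/-- If the exponential sum of `P(K (a - b))` over `A × A` is large and all homogeneous components
of `P` of degree more than `s` are nearly invisible to `χ`, then so is a multiple of the
component of degree `s`. -/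
theorem exists_homComp_phaseDist_le {d D : ℕ} {p : Fin d → MvPolynomial (Fin d) ℤ}
    (hD : ∀ i, (p i).totalDegree ≤ D) (hD0 : 0 < D) {ε : ℝ} (hε : 0 < ε) :
    ∃ Q : ℕ, 0 < Q ∧ ∀ W : ℕ, 0 < W → ∃ M : ℕ, ∀ K s, 2 ≤ s → s ≤ D →
      ∀ A ⊆ cube d M, ∀ χ : AddChar (Fin d → ℤ) Circle,
      (∀ r, s < r → r ≤ D → ∀ v ∈ cube d (2 * M),
        phaseDist χ (K ^ r • homComp p r v) ≤ ε / 2 / D) →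
      ε * (#(cube d M) : ℝ) ^ 2 ≤ ‖∑ a ∈ A, ∑ b ∈ A, (χ (evalMap p (K • (a - b))) : ℂ)‖ →
      ∀ v ∈ cube d W, phaseDist χ ((Q * K ^ s) • homComp p s v) ≤ 1 / W := by
  classical
  choose q hq hqW using fun s => weyl_two_weights (Fin d → ℤ) d s (half_pos hε)
  set Q := ∏ s ∈ range (D + 1), q s * (s + 2).factorial with hQ
  have hQ0 : 0 < Q := prod_pos fun s _ => Nat.mul_pos (hq s) (Nat.factorial_pos _)
  refine ⟨Q, hQ0, fun W hW => ?_⟩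
  have hη : (0 : ℝ) < 1 / W / Q := by positivity
  choose M₀ hM₀ using fun s => hqW s W _ hη
  refine ⟨(range (D + 1)).sup M₀, fun K s hs hsD A hA χ h hlarge v hv => ?_⟩
  obtain ⟨j, rfl⟩ : ∃ j, s = j + 2 := ⟨s - 2, by omega⟩
  have hj : j ∈ range (D + 1) := mem_range.2 (by omega)
  set M := (range (D + 1)).sup M₀ with hM
  have hind : ∑ a ∈ cube d M, ∑ b ∈ cube d M, (if a ∈ A then (1 : ℂ) else 0) *
      (if b ∈ A then (1 : ℂ) else 0) * χ (truncComp p (j + 2) K (a - b)) =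
      ∑ a ∈ A, ∑ b ∈ A, (χ (truncComp p (j + 2) K (a - b)) : ℂ) := by
    refine Eq.symm ((sum_congr rfl fun a ha => ?_).trans (sum_subset hA fun a _ ha => ?_))
    · refine (sum_congr rfl fun b hb => ?_).trans (sum_subset hA fun b _ hb => ?_)
      · rw [if_pos ha, if_pos hb, one_mul, one_mul]
      · rw [if_neg hb, mul_zero, zero_mul]
    · exact sum_eq_zero fun b _ => by rw [if_neg ha, zero_mul, zero_mul]
  have hite : ∀ a, ‖(if a ∈ A then (1 : ℂ) else 0)‖ ≤ 1 := fun a => by split_ifs <;> simp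
  have key := hM₀ j M (le_sup hj) _ (isPolyMap_truncComp p (j + 2) K) χ _ _ hite hite
    (hind ▸ le_norm_sum_truncComp hD hsD hD0 K M χ hA hε.le h hlarge) v hv
  obtain ⟨c, hc⟩ := dvd_prod_of_mem (fun s => q s * (s + 2).factorial) hj
  rw [← hQ] at hc
  have hcQ : c ≤ Q := by
    rw [hc]
    exact Nat.le_mul_of_pos_left c (Nat.mul_pos (hq j) (Nat.factorial_pos _))
  have heq : (Q * K ^ (j + 2)) • homComp p (j + 2) v =
      c • q j • (Δ_[v])^[j + 2] (truncComp p (j + 2) K) 0 := by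
    rw [fwdDiff_iter_truncComp, smul_smul, smul_smul, hc]
    congr 1
    ring
  rw [heq]
  calc _ ≤ c * phaseDist χ (q j • (Δ_[v])^[j + 2] (truncComp p (j + 2) K) 0) :=
        phaseDist_nsmul_le _ _ _
    _ ≤ Q * (1 / W / Q) := by
        gcongr
        exact phaseDist_nonneg _ _
    _ = 1 / W := by field_simp

theorem exists_scales (J : ℕ) (M₀ : ℕ → ℕ) (thr : ℕ → ℕ → ℕ) :
    ∃ W : ℕ → ℕ, (∀ j, 0 < W j) ∧ ∀ i j, i < j → j ≤ J → thr j (M₀ (W j)) ≤ W i := by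
  let U : ℕ → ℕ := fun j => Nat.rec 1 (fun j w => max w (thr (J - j) (M₀ w))) j
  have hU : ∀ j, U (j + 1) = max (U j) (thr (J - j) (M₀ (U j))) := fun j => rfl
  have hmono : Monotone U := monotone_nat_of_le_succ fun j => by rw [hU]; exact le_max_left _ _
  refine ⟨fun j => U (J - j), fun j => one_pos.trans_le (hmono (Nat.zero_le (J - j))),
    fun i j hij hj => ?_⟩
  have h : thr j (M₀ (U (J - j))) ≤ U (J - j + 1) := by
    rw [hU, Nat.sub_sub_self hj]
    exact le_max_right _ _
  have hle : J - j + 1 ≤ J - i := by omega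
  exact h.trans (hmono hle)

theorem exists_lt_of_le_card {D : ℕ} {L : Finset ℕ} {H : ℕ → ℕ → Prop}
    (step : ∀ i ∈ L, ∀ s, 2 ≤ s → s ≤ D → (∀ r, s < r → r ≤ D → ∃ i' < i, H r i') → H s i)
    (t i : ℕ) (ht : t ≤ #{j ∈ L | j < i}) (s : ℕ) (hs : 2 ≤ s) (hsD : s ≤ D) (hst : D < s + t) :
    ∃ i' < i, H s i' := by
  induction t generalizing i s with
  | zero => omega
  | succ t ih =>
    have hne : {j ∈ L | j < i}.Nonempty := card_pos.1 (by omega)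
    set i₁ := {j ∈ L | j < i}.max' hne with hi₁
    obtain ⟨hi₁L, hi₁i⟩ := mem_filter.1 (max'_mem _ hne)
    have hcard : t ≤ #{j ∈ L | j < i₁} := by
      have hsub : {j ∈ L | j < i}.erase i₁ ⊆ {j ∈ L | j < i₁} := by
        intro j hj
        obtain ⟨hji, hj⟩ := mem_erase.1 hj
        exact mem_filter.2 ⟨(mem_filter.1 hj).1, lt_of_le_of_ne (le_max' _ _ hj) hji⟩
      have h1 := card_le_card hsub
      rw [card_erase_of_mem (max'_mem _ hne)] at h1
      omega
    by_cases h : D < s + t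
    · obtain ⟨i', hi', hH⟩ := ih i₁ hcard s hs hsD h
      exact ⟨i', hi'.trans hi₁i, hH⟩
    · exact ⟨i₁, hi₁i, step i₁ hi₁L s hs hsD fun r hr hrD =>
        ih i₁ hcard r (by omega) hrD (by omega)⟩

theorem card_filter_not_le {D : ℕ} {L : Finset ℕ} {H : ℕ → ℕ → Prop} {full : ℕ → Prop}
    [DecidablePred full]
    (step : ∀ i ∈ L, ∀ s, 2 ≤ s → s ≤ D → (∀ r, s < r → r ≤ D → ∃ i' < i, H r i') → H s i)
    (hfull : ∀ i ∈ L, (∀ s, 2 ≤ s → s ≤ D → ∃ i' < i, H s i') → full i) :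
    #{i ∈ L | ¬ full i} ≤ D := by
  by_contra hlt
  have hne : {i ∈ L | ¬ full i}.Nonempty := card_pos.1 (by omega)
  set i₁ := {i ∈ L | ¬ full i}.max' hne with hi₁
  obtain ⟨hi₁L, hi₁f⟩ := mem_filter.1 (max'_mem _ hne)
  have hsub : {i ∈ L | ¬ full i}.erase i₁ ⊆ {j ∈ L | j < i₁} := by
    intro j hj
    obtain ⟨hji, hj⟩ := mem_erase.1 hj
    exact mem_filter.2 ⟨(mem_filter.1 hj).1, lt_of_le_of_ne (le_max' _ _ hj) hji⟩
  have h1 := card_le_card hsub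
  rw [card_erase_of_mem (max'_mem _ hne)] at h1
  exact hi₁f (hfull i₁ hi₁L fun s hs hsD =>
    exists_lt_of_le_card step D i₁ (by omega) s hs hsD (by omega))

theorem exists_evalMap_nsmul_eq {d D : ℕ} {p : Fin d → MvPolynomial (Fin d) ℤ}
    (hp0 : ∀ i, MvPolynomial.constantCoeff (p i) = 0) (hD : ∀ i, (p i).totalDegree ≤ D)
    (K : ℕ) (v : Fin d → ℤ) : ∃ z, evalMap p (K • v) = K • z := by
  refine ⟨∑ r ∈ Ioc 0 D, K ^ (r - 1) • homComp p r v, ?_⟩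
  rw [evalMap_nsmul_eq hD (Nat.zero_le D), truncComp, zero_add, sum_range_one, homComp_zero hp0,
    zero_add, smul_sum]
  refine sum_congr rfl fun r hr => ?_
  rw [smul_smul, mul_pow_sub_one (mem_Ioc.1 hr).1.ne']

/-- The dilation factors used at successive scales. -/
def dilation (c D : ℕ) : ℕ → ℕ
  | 0 => 1
  | i + 1 => c * dilation c D i ^ D

theorem dilation_pos {c : ℕ} (hc : 0 < c) (D i : ℕ) : 0 < dilation c D i := by
  induction i with
  | zero => exact one_pos
  | succ i ih => exact Nat.mul_pos hc (pow_pos ih D)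

theorem dilation_dvd {c D : ℕ} (hD : D ≠ 0) {i j : ℕ} (hij : i ≤ j) :
    dilation c D i ∣ dilation c D j := by
  induction j, hij using Nat.le_induction with
  | base => exact dvd_rfl
  | succ j _ ih => exact ih.trans ((dvd_pow_self _ hD).mul_left c)

theorem phaseDist_le_of_dvd {A : Type*} [AddCommGroup A] {a b W : ℕ} (hab : a ∣ b) {B : ℕ}
    (hbB : b ≤ B) (hB : 0 < B) (hW : 0 < W) (χ : AddChar A Circle) (x : A)
    (h : phaseDist χ (a • x) ≤ 1 / W) : phaseDist χ (b • x) ≤ B / W := by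
  obtain ⟨c, rfl⟩ := hab
  rcases Nat.eq_zero_or_pos a with rfl | ha
  · simp only [zero_mul, zero_smul, phaseDist_zero]
    positivity
  have hcB : c ≤ B := (Nat.le_mul_of_pos_left c ha).trans hbB
  rw [mul_comm, mul_smul]
  calc _ ≤ c * phaseDist χ (a • x) := phaseDist_nsmul_le _ _ _
    _ ≤ B * (1 / W) := by
      gcongr
      exact phaseDist_nonneg _ _
    _ = B / W := by ring

/-- Along a suitable sequence of dilations and boxes, every character is bad at no more than `D`
scales: at any other scale, either its exponential sum is small or it nearly annihilates all the
frequencies involved. -/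
theorem exists_scales_card_bad_le {d D : ℕ} {p : Fin d → MvPolynomial (Fin d) ℤ}
    (hp0 : ∀ i, MvPolynomial.constantCoeff (p i) = 0)
    (hdeg : ∀ a : Fin d → ℚ, a ≠ 0 →
      2 ≤ (∑ i, a i • (p i).map (Int.castRingHom ℚ)).totalDegree)
    (hD : ∀ i, (p i).totalDegree ≤ D) (hD2 : 2 ≤ D) {ε : ℝ} (hε : 0 < ε) (J : ℕ) :
    ∃ K : ℕ → ℕ, (∀ i, 0 < K i) ∧ ∀ m : Fin d → ℤ, ∃ M : ℕ → ℕ,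
      ∀ χ : AddChar (Fin d → ℤ) Circle, ∀ A : ℕ → Finset (Fin d → ℤ),
      (∀ i, A i ⊆ cube d (M i)) → ∃ T : Finset ℕ, #T ≤ D ∧ ∀ i ≤ J, i ∉ T →
        ε * (#(cube d (M i)) : ℝ) ^ 2 ≤
          ‖∑ a ∈ A i, ∑ b ∈ A i, (χ (evalMap p (K i • (a - b))) : ℂ)‖ →
        ∀ a ∈ A i, ∀ b ∈ A i, phaseDist χ (evalMap p (K i • (a - b)) - K J • m) ≤ 1 / 2 := by
  classical
  have hD0 : 0 < D := by omega
  obtain ⟨Q, hQ, hlevel⟩ := exists_homComp_phaseDist_le hD hD0 hε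
  obtain ⟨n, hn, hspan⟩ := exists_forall_nsmul_single_mem_closure hdeg hD
  set K := dilation (n * Q) D with hK
  have hKpos : ∀ i, 0 < K i := dilation_pos (Nat.mul_pos hn hQ) D
  have hKdvd : ∀ {i j}, i ≤ j → K i ∣ K j := dilation_dvd hD0.ne'
  have hQdvd : ∀ {i j s}, i ≤ j → s ≤ D → Q * K i ^ s ∣ Q * K j ^ D := fun hij hs =>
    mul_dvd_mul_left Q ((pow_dvd_pow_of_dvd (hKdvd hij) _).trans (pow_dvd_pow _ hs))
  have hKsucc : ∀ j, K (j + 1) = n * (Q * K j ^ D) := fun j => mul_assoc _ _ _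
  refine ⟨K, hKpos, fun m => ?_⟩
  set B := K J ^ D with hB
  have hBpos : 0 < B := pow_pos (hKpos J) D
  have hKJ : ∀ {j}, j ≤ J → K j ≤ K J := fun hj => Nat.le_of_dvd (hKpos J) (hKdvd hj)
  have hKJB : K J ≤ B := Nat.le_self_pow hD0.ne' _
  choose! M₀ hM₀ using hlevel
  have hfreq : ∀ j y, ∃ z, j ≤ J → evalMap p (K j • y) - K J • m = K j • z := by
    intro j y
    by_cases hj : j ≤ J
    · obtain ⟨z, hz⟩ := exists_evalMap_nsmul_eq hp0 hD (K j) y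
      obtain ⟨c, hc⟩ := hKdvd hj
      exact ⟨z - c • m, fun _ => by rw [hz, hc, mul_smul, smul_sub]⟩
    · exact ⟨0, fun h => absurd h hj⟩
  choose z hz using hfreq
  choose W₀ hW₀ using fun (j M : ℕ) => exists_phaseDist_nsmul_single_le hspan
    ((cube d (2 * M)).image (z j)) (one_half_pos (α := ℝ))
  obtain ⟨T₀, hT₀⟩ := exists_nat_ge (B / (ε / 2 / D))
  obtain ⟨W, hWpos, hW⟩ := exists_scales J M₀
    fun j M => max (2 * M) (max T₀ (B * max 1 (W₀ j M)))
  refine ⟨fun j => M₀ (W j), fun χ A hA => ?_⟩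
  set H : ℕ → ℕ → Prop := fun s i => ∀ v ∈ cube d (W i),
    phaseDist χ ((Q * K i ^ s) • homComp p s v) ≤ 1 / W i with hH
  set large : ℕ → Prop := fun i => ε * (#(cube d (M₀ (W i))) : ℝ) ^ 2 ≤
    ‖∑ a ∈ A i, ∑ b ∈ A i, (χ (evalMap p (K i • (a - b))) : ℂ)‖ with hlarge
  set full : ℕ → Prop := fun i => ∀ a ∈ A i, ∀ b ∈ A i,
    phaseDist χ (evalMap p (K i • (a - b)) - K J • m) ≤ 1 / 2 with hfulldef
  set L : Finset ℕ := {i ∈ range (J + 1) | large i} with hL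
  refine ⟨{i ∈ L | ¬ full i}, card_filter_not_le (H := H) ?_ ?_, fun i hi hiT hil => ?_⟩
  · intro i hi s hs hsD hr
    obtain ⟨hiJ, hil⟩ := mem_filter.1 hi
    have hiJ : i ≤ J := Nat.lt_succ_iff.1 (mem_range.1 hiJ)
    refine hM₀ (W i) (hWpos i) (K i) s hs hsD (A i) (hA i) χ (fun r hsr hrD v hv => ?_) hil
    obtain ⟨i', hi', hHr⟩ := hr r hsr hrD
    have hthr := hW i' i hi' hiJ
    have hv' : v ∈ cube d (W i') := cube_mono (le_of_max_le_left hthr) hv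
    have hdvd : Q * K i' ^ r ∣ K i ^ r := by
      refine (hQdvd le_rfl hrD).trans (Dvd.dvd.trans ?_
        ((hKdvd (Nat.succ_le_of_lt hi')).trans (dvd_pow_self _ (by omega))))
      rw [hKsucc]
      exact Dvd.intro_left _ rfl
    have hle : K i ^ r ≤ B := (Nat.pow_le_pow_left (hKJ hiJ) r).trans
      (Nat.pow_le_pow_right (hKpos J) hrD)
    refine (phaseDist_le_of_dvd hdvd hle hBpos (hWpos i') χ _ (hHr v hv')).trans ?_
    have hTW : (T₀ : ℝ) ≤ W i' := by
      exact_mod_cast le_of_max_le_left (le_of_max_le_right hthr)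
    have hWi : (0 : ℝ) < W i' := Nat.cast_pos.2 (hWpos i')
    have hD' : (0 : ℝ) < D := Nat.cast_pos.2 hD0
    rw [div_le_comm₀ hWi (by positivity)]
    exact hT₀.trans hTW
  · intro i hi hall a ha b hb
    obtain ⟨hiJ, hil⟩ := mem_filter.1 hi
    have hiJ : i ≤ J := Nat.lt_succ_iff.1 (mem_range.1 hiJ)
    obtain ⟨i₀, hi₀, -⟩ := hall 2 le_rfl hD2
    obtain ⟨j, rfl⟩ : ∃ j, i = j + 1 := ⟨i - 1, by omega⟩
    have hKstar : Q * K j ^ D ≤ B := by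
      refine ((Nat.le_mul_of_pos_left _ hn).trans ?_).trans hKJB
      rw [← hKsucc]
      exact hKJ hiJ
    set χ' : AddChar (Fin d → ℤ) Circle :=
      χ.compAddMonoidHom (nsmulAddMonoidHom (Q * K j ^ D)) with hχ'
    have hphase : ∀ x, phaseDist χ' x = phaseDist χ ((Q * K j ^ D) • x) := fun x => rfl
    have hy : a - b ∈ cube d (2 * M₀ (W (j + 1))) := by
      rw [two_mul]
      exact sub_mem_cube (hA _ ha) (hA _ hb)
    have key := hW₀ (j + 1) (M₀ (W (j + 1))) (max 1 (W₀ (j + 1) (M₀ (W (j + 1)))))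
      (le_max_right _ _) χ' (fun s hs hsD v hv => ?_) _ (mem_image_of_mem _ hy)
    · rw [hphase, smul_smul, mul_comm, ← hKsucc] at key
      rwa [hz (j + 1) (a - b) hiJ]
    · obtain ⟨i', hi', hHs⟩ := hall s hs hsD
      have hthr := hW i' (j + 1) hi' hiJ
      set W₁ := max 1 (W₀ (j + 1) (M₀ (W (j + 1)))) with hW₁
      have hBW : B * W₁ ≤ W i' := le_of_max_le_right (le_of_max_le_right hthr)
      have hv' : v ∈ cube d (W i') :=
        cube_mono ((Nat.le_mul_of_pos_left W₁ hBpos).trans hBW) hv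
      rw [hphase]
      refine (phaseDist_le_of_dvd (hQdvd (by omega) hsD) hKstar hBpos (hWpos i') χ _
        (hHs v hv')).trans ?_
      have hW₁pos : (0 : ℝ) < W₁ := Nat.cast_pos.2 (one_pos.trans_le (le_max_left _ _))
      have hWi : (0 : ℝ) < W i' := Nat.cast_pos.2 (hWpos i')
      rw [div_le_div_iff₀ hWi hW₁pos, one_mul]
      exact_mod_cast hBW
  · by_contra hnf
    exact hiT (mem_filter.2 ⟨mem_filter.2 ⟨mem_range.2 (Nat.lt_succ_of_le hi), hil⟩, hnf⟩)

/-- A finite family of characters of `ℤ^d` that detects zero within the box of side `3 N`. -/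
theorem exists_char_family (d N : ℕ) :
    ∃ (ι : Type) (_ : Fintype ι) (χ : ι → AddChar (Fin d → ℤ) Circle) (i₀ : ι),
      χ i₀ = 1 ∧ Fintype.card ι = 2 ^ d * #(cube d N) ∧
      ∀ w ∈ cube d (3 * N), ∑ i, (χ i w : ℂ) = if w = 0 then (Fintype.card ι : ℂ) else 0 := by
  classical
  set L := 2 * (2 * N + 1) with hL
  have : NeZero L := ⟨by omega⟩
  let π : (Fin d → ℤ) →+ (Fin d → ZMod L) := (Int.castAddHom (ZMod L)).compLeft (Fin d)
  refine ⟨AddChar (Fin d → ZMod L) ℂ, inferInstance,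
    fun ψ => (AddChar.circleEquivComplex.symm ψ).compAddMonoidHom π, 1, ?_, ?_, fun w hw => ?_⟩
  · ext w
    rfl
  · rw [AddChar.card_eq, Fintype.card_fun, ZMod.card, Fintype.card_fin, card_cube, hL, mul_pow]
  · have h1 : ∀ ψ : AddChar (Fin d → ZMod L) ℂ,
        (((AddChar.circleEquivComplex.symm ψ).compAddMonoidHom π w : Circle) : ℂ) = ψ (π w) :=
      fun ψ => rfl
    simp only [h1]
    rw [AddChar.sum_apply_eq_ite, AddChar.card_eq]
    refine if_congr ⟨fun h => ?_, fun h => by rw [h, map_zero]⟩ rfl rfl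
    ext i
    have h2 : ((w i : ℤ) : ZMod L) = 0 := congrFun h i
    rw [ZMod.intCast_zmod_eq_zero_iff_dvd] at h2
    refine Int.eq_zero_of_abs_lt_dvd h2 ((mem_cube.1 hw i).trans_lt ?_)
    rw [hL]
    push_cast
    omega

theorem norm_sum_char_sq {V : Type*} [AddCommGroup V] (χ : AddChar V Circle) (E : Finset V) :
    ((‖∑ x ∈ E, (χ x : ℂ)‖ ^ 2 : ℝ) : ℂ) = ∑ x ∈ E, ∑ y ∈ E, (χ (x - y) : ℂ) := by
  push_cast
  rw [← Complex.mul_conj', map_sum, sum_mul_sum]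
  refine sum_congr rfl fun x _ => sum_congr rfl fun y _ => ?_
  rw [← Circle.coe_inv_eq_conj, ← Circle.coe_mul, AddChar.map_sub_eq_div, div_eq_mul_inv]

section CharFamily

variable {d N : ℕ} {ι : Type*} [Fintype ι] {χ : ι → AddChar (Fin d → ℤ) Circle}

theorem sum_norm_sum_char_sq_mul
    (hχ : ∀ w ∈ cube d (3 * N), ∑ i, (χ i w : ℂ) = if w = 0 then (Fintype.card ι : ℂ) else 0)
    {E : Finset (Fin d → ℤ)} (hE : E ⊆ cube d N) {z : Fin d → ℤ} (hz : z ∈ cube d N) :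
    ∑ i, ((‖∑ x ∈ E, (χ i x : ℂ)‖ ^ 2 : ℝ) : ℂ) * χ i z =
      ∑ x ∈ E, ∑ y ∈ E, if x - y + z = 0 then (Fintype.card ι : ℂ) else 0 := by
  simp only [norm_sum_char_sq, sum_mul]
  rw [sum_comm]
  refine sum_congr rfl fun x hx => ?_
  rw [sum_comm]
  refine sum_congr rfl fun y hy => ?_
  rw [← hχ (x - y + z) (by
    rw [show 3 * N = N + N + N by ring]
    exact add_mem_cube (sub_mem_cube (hE hx) (hE hy)) hz)]
  exact sum_congr rfl fun i _ => by rw [AddChar.map_add_eq_mul, Circle.coe_mul]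

theorem sum_norm_sum_char_sq
    (hχ : ∀ w ∈ cube d (3 * N), ∑ i, (χ i w : ℂ) = if w = 0 then (Fintype.card ι : ℂ) else 0)
    {E : Finset (Fin d → ℤ)} (hE : E ⊆ cube d N) :
    ∑ i, ‖∑ x ∈ E, (χ i x : ℂ)‖ ^ 2 = Fintype.card ι * #E := by
  have h := sum_norm_sum_char_sq_mul hχ hE (zero_mem_cube d N)
  simp only [AddChar.map_zero_eq_one, Circle.coe_one, mul_one, add_zero, sub_eq_zero,
    sum_ite_eq] at h
  rw [sum_congr rfl fun x hx => if_pos hx, sum_const, nsmul_eq_mul, mul_comm] at h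
  exact_mod_cast h

/-- If no difference of elements of `E` is a value of `-w` on `A × A`, then the characters at which
the exponential sum of `w` is neither small nor positive carry a large part of the energy of `E`. -/
theorem le_sum_bad_norm_sum_char_sq
    (hχ : ∀ w ∈ cube d (3 * N), ∑ i, (χ i w : ℂ) = if w = 0 then (Fintype.card ι : ℂ) else 0)
    {i₀ : ι} (hi₀ : χ i₀ = 1) {E : Finset (Fin d → ℤ)} (hE : E ⊆ cube d N) {B : Type*}
    {A : Finset B} (hA : A.Nonempty) {w : B → B → Fin d → ℤ}
    (hw : ∀ a ∈ A, ∀ b ∈ A, w a b ∈ cube d N)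
    (hE0 : ∀ a ∈ A, ∀ b ∈ A, ∀ x ∈ E, ∀ y ∈ E, x - y + w a b ≠ 0) {η : ℝ}
    (hη : 2 * η * Fintype.card ι ≤ (#A : ℝ) ^ 2 * #E) (hη0 : 0 ≤ η) {bad : Finset ι}
    (hbad : ∀ i ∉ bad, η ≤ ‖∑ a ∈ A, ∑ b ∈ A, (χ i (w a b) : ℂ)‖ →
      ∀ a ∈ A, ∀ b ∈ A, phaseDist (χ i) (w a b) ≤ 1) :
    (#E : ℝ) ^ 2 ≤ 2 * ∑ i ∈ bad, ‖∑ x ∈ E, (χ i x : ℂ)‖ ^ 2 := by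
  classical
  set μ : ι → ℝ := fun i => ‖∑ x ∈ E, (χ i x : ℂ)‖ ^ 2 with hμ
  set S : ι → ℂ := fun i => ∑ a ∈ A, ∑ b ∈ A, (χ i (w a b) : ℂ) with hS
  have hμ0 : ∀ i, 0 ≤ μ i := fun i => by positivity
  have hzero : ∑ i, (μ i : ℂ) * S i = 0 := by
    simp only [hS, mul_sum]
    rw [sum_comm]
    refine sum_eq_zero fun a ha => ?_
    rw [sum_comm]
    refine sum_eq_zero fun b hb => ?_
    rw [hμ, sum_norm_sum_char_sq_mul hχ hE (hw a ha b hb)]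
    exact sum_eq_zero fun x hx => sum_eq_zero fun y hy => if_neg (hE0 a ha b hb x hx y hy)
  have hre : ∑ i, μ i * (S i).re = 0 := by
    have := congrArg Complex.re hzero
    simpa [Complex.re_sum] using this
  have hSi₀ : S i₀ = (#A : ℂ) ^ 2 := by
    simp only [hS, hi₀, AddChar.one_apply, Circle.coe_one, sum_const, nsmul_eq_mul]
    ring
  have hμi₀ : μ i₀ = (#E : ℝ) ^ 2 := by
    simp [hμ, hi₀]
  have hSnorm : ∀ i, ‖S i‖ ≤ (#A : ℝ) ^ 2 := fun i => by
    calc _ ≤ ∑ a ∈ A, ∑ b ∈ A, (1 : ℝ) := norm_sum_le_of_le _ fun a _ =>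
          norm_sum_le_of_le _ fun b _ => (Circle.norm_coe _).le
      _ = _ := by
          simp only [sum_const, nsmul_eq_mul]
          ring
  have hpoint : ∀ i, (if i = i₀ then (#A : ℝ) ^ 2 else 0) - (if i ∈ bad then (#A : ℝ) ^ 2 else 0)
      - η ≤ (S i).re := by
    intro i
    have hA2 : (0 : ℝ) ≤ (#A : ℝ) ^ 2 := by positivity
    by_cases hi : i = i₀
    · have : (S i).re = (#A : ℝ) ^ 2 := by
        rw [hi, hSi₀]
        exact_mod_cast Complex.ofReal_re ((#A : ℝ) ^ 2)
      rw [this, if_pos hi]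
      split_ifs <;> linarith
    · rw [if_neg hi]
      have hneg := neg_le_of_abs_le (Complex.abs_re_le_norm (S i))
      by_cases hib : i ∈ bad
      · rw [if_pos hib]
        linarith [hSnorm i]
      · rw [if_neg hib]
        by_cases hlarge : η ≤ ‖S i‖
        · have : 0 ≤ (S i).re := by
            rw [hS]
            simp only [Complex.re_sum]
            refine sum_nonneg fun a ha => sum_nonneg fun b hb => ?_
            have h1 := hbad i hib hlarge a ha b hb
            have h2 := neg_le_of_abs_le (Complex.abs_re_le_norm ((χ i (w a b) : ℂ) - 1))
            rw [Complex.sub_re, Complex.one_re] at h2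
            rw [phaseDist] at h1
            linarith
          linarith
        · linarith
  have hsum : ∑ i, μ i * ((if i = i₀ then (#A : ℝ) ^ 2 else 0) -
      (if i ∈ bad then (#A : ℝ) ^ 2 else 0) - η) ≤ 0 :=
    (sum_le_sum fun i _ => mul_le_mul_of_nonneg_left (hpoint i) (hμ0 i)).trans_eq hre
  simp only [mul_sub, sum_sub_distrib, mul_ite, mul_zero, sum_ite_eq', mem_univ, if_true,
    sum_ite_mem, univ_inter, ← sum_mul] at hsum
  rw [hμi₀, hμ, sum_norm_sum_char_sq hχ hE] at hsum
  have hApos : (0 : ℝ) < (#A : ℝ) ^ 2 := by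
    have : (0 : ℝ) < #A := Nat.cast_pos.2 hA.card_pos
    positivity
  refine le_of_mul_le_mul_left ?_ hApos
  have hmul := mul_le_mul_of_nonneg_right hη (Nat.cast_nonneg (α := ℝ) #E)
  nlinarith

end CharFamily

theorem exists_card_filter_add_nsmul_mem {d : ℕ} {E : Finset (Fin d → ℤ)} {M N K : ℕ}
    (hE : E ⊆ cube d N) (hKM : K * M ≤ N) :
    ∃ t, #E * #(cube d M) ≤ 2 ^ d * #(cube d N) * #{a ∈ cube d M | t + K • a ∈ E} := by
  have hsum : ∑ t ∈ cube d (2 * N), #{a ∈ cube d M | t + K • a ∈ E} = #E * #(cube d M) := by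
    simp only [card_filter]
    rw [sum_comm, mul_comm (#E)]
    refine (sum_congr rfl fun a ha => ?_).trans (sum_const_nat fun _ _ => rfl)
    rw [← card_filter]
    refine card_bij (fun t _ => t + K • a) (fun t ht => (mem_filter.1 ht).2)
      (fun t _ t' _ h => add_right_cancel h) fun x hx =>
        ⟨x - K • a, mem_filter.2 ⟨?_, by rwa [sub_add_cancel]⟩, sub_add_cancel _ _⟩
    rw [two_mul]
    exact sub_mem_cube (hE hx) (cube_mono hKM (nsmul_mem_cube ha K))
  obtain ⟨t, -, ht⟩ := exists_max_image (cube d (2 * N))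
    (fun t => #{a ∈ cube d M | t + K • a ∈ E}) ⟨0, zero_mem_cube d _⟩
  refine ⟨t, hsum ▸ (sum_le_card_nsmul _ _ _ ht).trans ?_⟩
  rw [smul_eq_mul]
  exact Nat.mul_le_mul_right _ (card_cube_mul_le d N 2 one_le_two)

theorem exists_translate_of_le_upperBanachDensity {d : ℕ} {E : Set (Fin d → ℤ)} {δ δ' : ℝ}
    (hδ : δ ≤ upperBanachDensity d E) (hδ' : δ' < δ) (N₀ : ℕ) :
    ∃ N ≥ N₀, ∃ (t : Fin d → ℤ) (E' : Finset (Fin d → ℤ)), E' ⊆ cube d N ∧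
      (∀ x ∈ E', x + t ∈ E) ∧ δ' * #(cube d N) ≤ #E' := by
  classical
  have hfreq := frequently_lt_of_lt_limsup
    (isCoboundedUnder_le_of_le atTop (x := 0) fun N => Real.iSup_nonneg fun t => by positivity)
    (hδ'.trans_le hδ)
  obtain ⟨N, hN, hlt⟩ := (frequently_atTop.1 hfreq) N₀
  obtain ⟨t, ht⟩ := exists_lt_of_lt_ciSup hlt
  refine ⟨N, hN, t, {x ∈ cube d N | x + t ∈ E}, filter_subset _ _,
    fun x hx => (mem_filter.1 hx).2, ?_⟩
  have hcard : (E ∩ {x | ∀ i, |x i - t i| ≤ (N : ℤ)}).ncard =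
      #{x ∈ cube d N | x + t ∈ E} := by
    rw [← Set.ncard_coe_finset]
    symm
    refine Set.ncard_congr (fun x _ => x + t) (fun x hx => ?_)
      (fun x y _ _ h => add_right_cancel h) fun x hx => ⟨x - t, ?_, sub_add_cancel _ _⟩
    · obtain ⟨hx, hxE⟩ := mem_filter.1 (mem_coe.1 hx)
      exact ⟨hxE, fun i => by simpa using mem_cube.1 hx i⟩
    · exact mem_coe.2 (mem_filter.2 ⟨mem_cube.2 hx.2, by rw [sub_add_cancel]; exact hx.1⟩)
  rw [hcard, lt_div_iff₀ (by positivity)] at ht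
  rw [card_cube]
  push_cast
  exact ht.le

theorem exists_dense_dilate {d : ℕ} {E : Finset (Fin d → ℤ)} {M N K : ℕ} {δ : ℝ}
    (hE : E ⊆ cube d N) (hcard : δ * #(cube d N) ≤ #E) (hKM : K * M ≤ N) :
    ∃ (t : Fin d → ℤ) (A : Finset (Fin d → ℤ)), A ⊆ cube d M ∧
      δ / 2 ^ d * #(cube d M) ≤ #A ∧ ∀ a ∈ A, t + K • a ∈ E := by
  classical
  obtain ⟨t, ht⟩ := exists_card_filter_add_nsmul_mem hE hKM
  refine ⟨t, {a ∈ cube d M | t + K • a ∈ E}, filter_subset _ _, ?_,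
    fun a ha => (mem_filter.1 ha).2⟩
  have hN : (0 : ℝ) < #(cube d N) := Nat.cast_pos.2 (card_cube_pos d N)
  have ht' : (#E : ℝ) * #(cube d M) ≤
      2 ^ d * #(cube d N) * #{a ∈ cube d M | t + K • a ∈ E} := by exact_mod_cast ht
  rw [div_mul_eq_mul_div, div_le_iff₀ (by positivity)]
  refine le_of_mul_le_mul_left ?_ hN
  have := mul_le_mul_of_nonneg_right hcard (Nat.cast_nonneg (α := ℝ) #(cube d M))
  linarith

theorem norm_sum_sum_char_sub {V B : Type*} [AddCommGroup V] (χ : AddChar V Circle)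
    (A : Finset B) (f : B → B → V) (z : V) :
    ‖∑ a ∈ A, ∑ b ∈ A, (χ (f a b - z) : ℂ)‖ = ‖∑ a ∈ A, ∑ b ∈ A, (χ (f a b) : ℂ)‖ := by
  have h : ∀ a b, (χ (f a b - z) : ℂ) = χ (f a b) * χ (-z) := fun a b => by
    rw [sub_eq_add_neg, AddChar.map_add_eq_mul, Circle.coe_mul]
  simp only [h, ← sum_mul]
  rw [norm_mul, Circle.norm_coe, mul_one]

/-- If every index is bad at no more than `D` scales, then the mass of the bad indices, summed over
all scales, is at most `D` times the total mass. -/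
theorem sum_sum_filter_mem_le {ι : Type*} [Fintype ι] {D : ℕ} {T : ι → Finset ℕ}
    (hT : ∀ i, #(T i) ≤ D) {μ : ι → ℝ} (hμ : ∀ i, 0 ≤ μ i) (R : Finset ℕ) :
    ∑ j ∈ R, ∑ i with j ∈ T i, μ i ≤ D * ∑ i, μ i := by
  simp only [sum_filter]
  rw [sum_comm, mul_sum]
  refine sum_le_sum fun i _ => ?_
  rw [← sum_filter, sum_const, nsmul_eq_mul]
  refine mul_le_mul_of_nonneg_right ?_ (hμ i)
  refine Nat.cast_le.2 ((card_le_card fun j hj => (mem_filter.1 hj).2).trans (hT i))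

end

/-- **Theorem D (Quantitative multi-dimensional polynomial Bogolyubov theorem).**
Let `P = (P₁, …, P_d) : ℤ^d → ℤ^d` be an integer polynomial map with zero constant term
such that every non-trivial rational linear combination of its components has degree at
least `2`. For every `δ > 0` there is `k = k(P, δ)` such that for every `E ⊆ ℤ^d` with
`d*(E) ≥ δ` and every `m ∈ ℤ^d` there are `x₁, x₂, y₁, y₂ ∈ E` with
`k • m = (x₁ - x₂) + P(y₁ - y₂)`. -/
theorem quantitative_multidimensional_polynomial_bogolyubov
    (d : ℕ) (p : Fin d → MvPolynomial (Fin d) ℤ)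
    (hp0 : ∀ i, MvPolynomial.constantCoeff (p i) = 0)
    (hdeg : ∀ a : Fin d → ℚ, a ≠ 0 →
      2 ≤ (∑ i, a i • (p i).map (Int.castRingHom ℚ)).totalDegree)
    (δ : ℝ) (hδ : 0 < δ) :
    ∃ k : ℕ, 0 < k ∧
      ∀ E : Set (Fin d → ℤ), δ ≤ upperBanachDensity d E →
        ∀ m : Fin d → ℤ, ∃ x₁ ∈ E, ∃ x₂ ∈ E, ∃ y₁ ∈ E, ∃ y₂ ∈ E,
          (k : ℤ) • m = (x₁ - x₂) + fun i => MvPolynomial.eval (y₁ - y₂) (p i) := by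
  classical
  set D := (Finset.univ.sup fun i => (p i).totalDegree) + 2
  have hD : ∀ i, (p i).totalDegree ≤ D := fun i =>
    (Finset.le_sup (f := fun i => (p i).totalDegree) (Finset.mem_univ i)).trans
      (Nat.le_add_right _ 2)
  set α : ℝ := δ / 2 / 2 ^ d with hα
  have hα0 : 0 < α := by positivity
  obtain ⟨J, hJ⟩ := exists_nat_gt (2 * D / α)
  obtain ⟨K, hK, hscales⟩ := exists_scales_card_bad_le hp0 hdeg hD (Nat.le_add_left 2 _)
    (by positivity : 0 < α ^ 3 / 2) J
  refine ⟨K J, hK J, fun E hE m => ?_⟩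
  by_contra hno
  obtain ⟨M, hM⟩ := hscales m
  set w : ℕ → (Fin d → ℤ) → (Fin d → ℤ) → Fin d → ℤ :=
    fun i a b => evalMap p (K i • (a - b)) - K J • m with hw
  obtain ⟨N₁, hN₁⟩ := exists_subset_cube ((Finset.range (J + 1)).biUnion fun i =>
    (cube d (M i) ×ˢ cube d (M i)).image fun q => w i q.1 q.2)
  obtain ⟨N, hN, t, E', hE'N, hE'E, hE'card⟩ := exists_translate_of_le_upperBanachDensity hE
    (half_lt_self hδ) (max N₁ ((Finset.range (J + 1)).sup fun i => K i * M i))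
  have hA : ∀ i, ∃ (u : Fin d → ℤ) (A : Finset (Fin d → ℤ)), A ⊆ cube d (M i) ∧
      (i ≤ J → α * ((cube d (M i)).card : ℝ) ≤ A.card ∧ ∀ a ∈ A, u + K i • a ∈ E') := by
    intro i
    by_cases hi : i ≤ J
    · have hKM : K i * M i ≤ N := (Finset.le_sup (f := fun i => K i * M i)
        (Finset.mem_range.2 (Nat.lt_succ_of_le hi))).trans (le_of_max_le_right hN)
      obtain ⟨u, A, hAM, hAc, hAE⟩ := exists_dense_dilate hE'N hE'card hKM
      exact ⟨u, A, hAM, fun _ => ⟨hAc, hAE⟩⟩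
    · exact ⟨0, ∅, Finset.empty_subset _, fun h => absurd h hi⟩
  choose u A hAM hA using hA
  obtain ⟨ι, _, χ, i₀, hi₀, hcard, hχ⟩ := exists_char_family d N
  choose T hTD hT using fun i => hM (χ i) A hAM
  have hNpos : (0 : ℝ) < (cube d N).card := Nat.cast_pos.2 (card_cube_pos d N)
  have hE'pos : (0 : ℝ) < E'.card := (by positivity : 0 < δ / 2 * ((cube d N).card : ℝ)).trans_le hE'card
  have hι : α * Fintype.card ι ≤ E'.card := by
    refine le_trans (le_of_eq ?_) hE'card
    rw [hcard, hα]
    push_cast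
    field_simp
  have hbad : ∀ j ∈ Finset.range (J + 1),
      (E'.card : ℝ) ^ 2 ≤ 2 * ∑ i with j ∈ T i, ‖∑ x ∈ E', (χ i x : ℂ)‖ ^ 2 := by
    intro j hjR
    have hj : j ≤ J := Nat.lt_succ_iff.1 (Finset.mem_range.1 hjR)
    obtain ⟨hAc, hAE⟩ := hA j hj
    have hMpos : (0 : ℝ) < (cube d (M j)).card := Nat.cast_pos.2 (card_cube_pos d (M j))
    have hApos : (0 : ℝ) < (A j).card := (mul_pos hα0 hMpos).trans_le hAc
    refine le_sum_bad_norm_sum_char_sq hχ hi₀ hE'N (Finset.card_pos.1 (Nat.cast_pos.1 hApos))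
      (w := w j) (η := α ^ 3 / 2 * ((cube d (M j)).card : ℝ) ^ 2) (fun a ha b hb => ?_)
      (fun a ha b hb x hx y hy h => hno ?_) ?_ (by positivity) fun i hi hlarge a ha b hb => ?_
    · refine cube_mono (le_of_max_le_left hN) (hN₁ (Finset.mem_biUnion.2 ⟨j, hjR, ?_⟩))
      exact Finset.mem_image.2 ⟨(a, b), Finset.mem_product.2 ⟨hAM j ha, hAM j hb⟩, rfl⟩
    · refine ⟨x + t, hE'E x hx, y + t, hE'E y hy, u j + K j • a + t, hE'E _ (hAE a ha),
        u j + K j • b + t, hE'E _ (hAE b hb), ?_⟩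
      have h1 : u j + K j • a + t - (u j + K j • b + t) = K j • (a - b) := by
        rw [smul_sub]
        abel
      have h2 : x - y + (evalMap p (K j • (a - b)) - K J • m) = 0 := h
      rw [h1, natCast_zsmul, add_sub_add_right_eq_sub]
      rw [← add_sub_assoc, sub_eq_zero] at h2
      exact h2.symm
    · calc 2 * (α ^ 3 / 2 * ((cube d (M j)).card : ℝ) ^ 2) * Fintype.card ι
          = (α * (cube d (M j)).card) ^ 2 * (α * Fintype.card ι) := by ring
        _ ≤ ((A j).card : ℝ) ^ 2 * E'.card := by gcongr
    · rw [norm_sum_sum_char_sub (χ i) (A j) (fun a b => evalMap p (K j • (a - b)))] at hlarge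
      have hjT : j ∉ T i := fun h => hi (Finset.mem_filter.2 ⟨Finset.mem_univ i, h⟩)
      exact (hT i j hj hjT hlarge a ha b hb).trans (by norm_num)
  have htotal : ((J : ℝ) + 1) * (E'.card : ℝ) ^ 2 ≤ 2 * (D * (Fintype.card ι * E'.card)) := by
    calc ((J : ℝ) + 1) * (E'.card : ℝ) ^ 2 = ∑ j ∈ Finset.range (J + 1), (E'.card : ℝ) ^ 2 := by
          rw [Finset.sum_const, Finset.card_range, nsmul_eq_mul]
          push_cast
          rfl
      _ ≤ _ := Finset.sum_le_sum hbad
      _ ≤ _ := by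
          rw [← Finset.mul_sum, ← sum_norm_sum_char_sq hχ hE'N]
          exact mul_le_mul_of_nonneg_left
            (sum_sum_filter_mem_le hTD (fun i => by positivity) _) two_pos.le
  rw [div_lt_iff₀ hα0] at hJ
  have hD0 : (0 : ℝ) ≤ 2 * D := by positivity
  have h1 : (J + 1) * α * (E'.card : ℝ) ^ 2 ≤ 2 * D * (E'.card : ℝ) ^ 2 := by
    calc (J + 1) * α * (E'.card : ℝ) ^ 2 = α * ((J + 1) * (E'.card : ℝ) ^ 2) := by ring
      _ ≤ α * (2 * (D * (Fintype.card ι * E'.card))) := by gcongr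
      _ = 2 * D * (α * Fintype.card ι) * E'.card := by ring
      _ ≤ 2 * D * E'.card * E'.card := by gcongr
      _ = _ := by ring
  have h2 := le_of_mul_le_mul_right h1 (by positivity)
  linarith
end

section
/- Counter-example to the pinned polynomial Bogolyubov theorem (Theorem E): Let P be a polynomial with integer coefficients in one variable with P(0) = 0 and deg P ≥ 2. Then there exists a set E ⊆ ℤ with upper Banach density d*(E) > 0 such that for every positive integer k there exists a positive integer m with the property that for all x, y ∈ E the set {k, 2k, …, mk} is not contained in (E − x) + P(E − y); that is, for all x, y ∈ E there exists j with 1 ≤ j ≤ m such that jk cannot be written as (e − x) + P(e' − y) with e, e' ∈ E. -/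
open MeasureTheory Filter
open scoped symmDiff

/-- Upper Banach density of a set `E ⊆ ℤ`:
`d*(E) = limsup_N sup_t |E ∩ ([-N, N] + t)| / (2N + 1)`. -/
noncomputable def upperBanachDensityZ (E : Set ℤ) : ℝ :=
  Filter.atTop.limsup fun N : ℕ =>
    ⨆ t : ℤ, ((E ∩ {x | |x - t| ≤ (N : ℤ)}).ncard : ℝ) / (2 * N + 1 : ℝ)

section

open Polynomial

theorem sum_eval_eq_neg_coeff {p : ℕ} [Fact p.Prime] (g : (ZMod p)[X]) (hg : g.natDegree ≤ p - 1) :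
    ∑ x : ZMod p, g.eval x = - g.coeff (p - 1) := by
  have hp : 0 < p - 1 := Nat.sub_pos_of_lt (Fact.out : p.Prime).one_lt
  simp_rw [eval_eq_sum_range' (Nat.lt_succ_of_le hg)]
  rw [Finset.sum_comm, Finset.sum_range_succ, Finset.sum_eq_zero]
  · rw [← Finset.mul_sum, zero_add]
    have : ∑ x : ZMod p, x ^ (p - 1) = -1 := by
      have h : ∀ x : ZMod p, x ^ (p - 1) = 1 - if x = 0 then 1 else 0 := by
        intro x
        split_ifs with h
        · simp [h, hp.ne']
        · simp [ZMod.pow_card_sub_one_eq_one h]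
      simp [h]
    rw [this]; ring
  · intro i hi
    rw [← Finset.mul_sum, FiniteField.sum_pow_lt_card_sub_one, mul_zero]
    simpa [ZMod.card] using hi

theorem esymm_eval_eq_zero {p : ℕ} [Fact p.Prime] {s : ZMod p → ZMod p} {u : ℕ} (hu : u ≤ p)
    (hs : ∀ j, 0 < j → j < u → ∑ x, s x ^ j = 0) (j : ℕ) (hj : 0 < j) (hju : j < u) :
    MvPolynomial.aeval s (MvPolynomial.esymm (ZMod p) (ZMod p) j) = 0 := by
  have h := congrArg (MvPolynomial.aeval s) (MvPolynomial.mul_esymm_eq_sum (ZMod p) (ZMod p) j)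
  rw [map_mul, map_mul, map_sum, Finset.sum_eq_zero, mul_zero] at h
  · rcases mul_eq_zero.1 h with h | h
    · rw [map_natCast, ZMod.natCast_eq_zero_iff] at h
      exact absurd (Nat.le_of_dvd hj h) (by omega)
    · exact h
  · intro a ha
    obtain ⟨ha, hlt : a.1 < j⟩ := Finset.mem_filter.1 ha
    have hadd := Finset.HasAntidiagonal.mem_antidiagonal.1 ha
    rw [map_mul, MvPolynomial.psum, map_sum]
    simp only [map_pow, MvPolynomial.aeval_X]
    rw [hs a.2 (by omega) (by omega), mul_zero]

theorem coeff_prod_X_sub_C_eq_zero {p : ℕ} [Fact p.Prime] {s : ZMod p → ZMod p} {u : ℕ}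
    (hu : u ≤ p) (hs : ∀ j, 0 < j → j < u → ∑ x, s x ^ j = 0) (n : ℕ) (hn : n < p)
    (hnu : p < n + u) : (∏ x, (X - C (s x))).coeff n = 0 := by
  have hc : (Multiset.map s Finset.univ.val).card = p := by simp [ZMod.card]
  have h := Multiset.prod_X_sub_C_coeff (Finset.univ.val.map s) (k := n) (by omega)
  rw [Multiset.map_map] at h
  refine h.trans ?_
  rw [← MvPolynomial.aeval_esymm_eq_multiset_esymm (ZMod p) (ZMod p), hc, esymm_eval_eq_zero hu hs]
    <;> first | omega | simp

/-- A polynomial over `ZMod p` whose degree `d ≥ 2` divides `p - 1` omits at least `(p - 1) / d`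
values: its values are roots of the nonzero polynomial `∏ x, (X - f x) - (X ^ p - X)`, whose degree
is bounded through the vanishing of the low power sums of the values. -/
theorem ncard_range_eval_le {p d : ℕ} [Fact p.Prime] (f : (ZMod p)[X]) (hf : f.natDegree = d)
    (hd : 2 ≤ d) (hdp : d ∣ p - 1) : (Set.range fun x => f.eval x).ncard ≤ p - (p - 1) / d := by
  obtain ⟨u, hu⟩ := hdp
  have hp := (Fact.out : p.Prime).one_lt
  have hu0 : 0 < u := Nat.pos_of_ne_zero (by rintro rfl; omega)
  have hup : 2 * u ≤ p - 1 := by rw [hu]; gcongr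
  rw [hu, Nat.mul_div_cancel_left _ (by omega)]
  have hs : ∀ j, 0 < j → j < u → ∑ x, (f.eval x) ^ j = 0 := by
    intro j hj hju
    have hlt : (f ^ j).natDegree < p - 1 := by
      rw [natDegree_pow, hf, hu, mul_comm]
      gcongr
    simp_rw [← eval_pow]
    rw [sum_eval_eq_neg_coeff _ hlt.le, coeff_eq_zero_of_natDegree_lt hlt, neg_zero]
  have hsu : ∑ x, (f.eval x) ^ u ≠ 0 := by
    have hdeg : (f ^ u).natDegree = p - 1 := by rw [natDegree_pow, hf, hu, mul_comm]
    simp_rw [← eval_pow]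
    rw [sum_eval_eq_neg_coeff _ hdeg.le, ← hdeg, coeff_natDegree, neg_ne_zero, leadingCoeff_ne_zero]
    apply pow_ne_zero
    rintro rfl
    simp at hf; omega
  set G : (ZMod p)[X] := ∏ x, (X - C (f.eval x)) - (X ^ p - X) with hG
  have hmonic : (∏ x : ZMod p, (X - C (f.eval x))).Monic := monic_prod_X_sub_C _ _
  have hnat : (∏ x : ZMod p, (X - C (f.eval x))).natDegree = p := by
    rw [natDegree_finsetProd_X_sub_C_eq_card]; simp [ZMod.card]
  have hGdeg : G.natDegree ≤ p - u := by
    rw [natDegree_le_iff_coeff_eq_zero]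
    intro n hn
    rw [hG, coeff_sub, coeff_sub, coeff_X_pow, coeff_X_of_ne_one (by omega)]
    rcases lt_trichotomy n p with h | h | h
    · rw [coeff_prod_X_sub_C_eq_zero (by omega) hs n h (by omega)]; simp [h.ne]
    · have := hmonic.coeff_natDegree
      rw [hnat] at this
      simp [h, this]
    · rw [coeff_eq_zero_of_natDegree_lt (by omega)]; simp [h.ne']
  have hGne : G ≠ 0 := by
    intro h0
    have hsurj : Function.Surjective fun x => f.eval x := by
      intro a
      have h1 := congrArg (eval a) h0
      simp only [hG, eval_sub, eval_prod, eval_X, eval_C, eval_pow, ZMod.pow_card, sub_self,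
        sub_zero, eval_zero, Finset.prod_eq_zero_iff, Finset.mem_univ, true_and] at h1
      obtain ⟨x, hx⟩ := h1
      exact ⟨x, (sub_eq_zero.1 hx).symm⟩
    apply hsu
    rw [(Function.Bijective.sum_comp (Finite.injective_iff_surjective.2 hsurj |>.bijective_of_finite)
      (fun y => y ^ u))]
    rw [FiniteField.sum_pow_lt_card_sub_one]
    rw [ZMod.card]; omega
  have hsub : (Set.range fun x => f.eval x) ⊆ (G.roots.toFinset : Set (ZMod p)) := by
    rintro _ ⟨x, rfl⟩
    simp only [Finset.mem_coe, Multiset.mem_toFinset, mem_roots hGne, IsRoot]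
    rw [hG, eval_sub, eval_prod, Finset.prod_eq_zero (Finset.mem_univ x) (by simp)]
    simp
  calc _ ≤ (G.roots.toFinset : Set (ZMod p)).ncard := Set.ncard_le_ncard hsub
    _ = G.roots.toFinset.card := Set.ncard_coe_finset _
    _ ≤ G.roots.card := Multiset.toFinset_card_le _
    _ ≤ _ := (card_roots' _).trans hGdeg

/-- The set of values of `P` modulo `q`. -/
def modRange (P : ℤ[X]) (q : ℕ) : Set (ZMod q) := Set.range fun z : ZMod q => aeval z P

theorem ncard_modRange_mul_le (P : ℤ[X]) {a b : ℕ} [NeZero a] [NeZero b] (h : a.Coprime b) :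
    (modRange P (a * b)).ncard ≤ (modRange P a).ncard * (modRange P b).ncard := by
  rw [← Set.ncard_prod]
  refine Set.ncard_le_ncard_of_injOn (ZMod.chineseRemainder h) ?_
    (ZMod.chineseRemainder h).injective.injOn
  rintro _ ⟨z, rfl⟩
  refine ⟨⟨(ZMod.chineseRemainder h z).1, ?_⟩, ⟨(ZMod.chineseRemainder h z).2, ?_⟩⟩
  · exact (map_aeval_eq_aeval_map (φ := RingHom.id ℤ)
      (ψ := (RingHom.fst _ _).comp (ZMod.chineseRemainder h).toRingHom)
      (RingHom.ext_int _ _) P z |>.trans (by simp)).symm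
  · exact (map_aeval_eq_aeval_map (φ := RingHom.id ℤ)
      (ψ := (RingHom.snd _ _).comp (ZMod.chineseRemainder h).toRingHom)
      (RingHom.ext_int _ _) P z |>.trans (by simp)).symm

theorem ncard_modRange_prime_le (P : ℤ[X]) (hP : 2 ≤ P.natDegree) {p : ℕ} (hp : p.Prime)
    (hlc : P.leadingCoeff.natAbs < p) (hmod : p ≡ 1 [MOD P.natDegree]) :
    ((modRange P p).ncard : ℝ) ≤ (1 - 1 / (2 * P.natDegree)) * p := by
  have := Fact.mk hp
  have hdvd : P.natDegree ∣ p - 1 := (Nat.modEq_iff_dvd' hp.one_lt.le).1 hmod.symm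
  have hlc' : (Int.castRingHom (ZMod p)) P.leadingCoeff ≠ 0 := by
    rw [eq_intCast, Ne, ZMod.intCast_zmod_eq_zero_iff_dvd]
    intro h
    have h2 := Nat.le_of_dvd (Int.natAbs_pos.2 (leadingCoeff_ne_zero.2 (by rintro rfl; simp at hP)))
      (Int.natCast_dvd.1 h)
    omega
  have h := ncard_range_eval_le (P.map (Int.castRingHom (ZMod p)))
    (natDegree_map_of_leadingCoeff_ne_zero _ hlc') hP hdvd
  have heq : modRange P p = Set.range fun x => (P.map (Int.castRingHom (ZMod p))).eval x := by
    simp only [modRange, eval_map, aeval_def, algebraMap_int_eq]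
  rw [← heq] at h
  have hd : (2 : ℝ) ≤ P.natDegree := by exact_mod_cast hP
  have hp2 : (2 : ℝ) ≤ p := by exact_mod_cast hp.two_le
  have h' : ((modRange P p).ncard : ℝ) ≤ p - (p - 1) / P.natDegree := by
    calc _ ≤ ((p - (p - 1) / P.natDegree : ℕ) : ℝ) := by exact_mod_cast h
      _ = _ := by
        rw [Nat.cast_sub ((Nat.div_le_self _ _).trans (Nat.sub_le _ _)),
          Nat.cast_div hdvd (by positivity), Nat.cast_sub hp.one_lt.le, Nat.cast_one]
  refine h'.trans ?_
  have : (p : ℝ) / 2 / P.natDegree ≤ (p - 1) / P.natDegree := by gcongr; linarith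
  have e : (1 - 1 / (2 * (P.natDegree : ℝ))) * p = p - p / 2 / P.natDegree := by field_simp
  linarith

theorem exists_modulus_pow (P : ℤ[X]) (hP : 2 ≤ P.natDegree) {B : ℕ} (hB : 0 < B) (r : ℕ) :
    ∃ q : ℕ, 0 < q ∧ q.Coprime B ∧
      ((modRange P q).ncard : ℝ) ≤ (1 - 1 / (2 * P.natDegree)) ^ r * q := by
  have hd : (2 : ℝ) ≤ P.natDegree := by exact_mod_cast hP
  have hc : (0 : ℝ) ≤ 1 - 1 / (2 * P.natDegree) := by
    rw [sub_nonneg, div_le_one (by positivity)]; linarith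
  induction r with
  | zero =>
    refine ⟨1, one_pos, Nat.coprime_one_left _, ?_⟩
    have := Set.ncard_le_card (modRange P 1)
    simpa using this
  | succ r ih =>
    obtain ⟨q, hq, hqB, hcard⟩ := ih
    obtain ⟨p, hp, hlt, hmod⟩ := Nat.exists_prime_gt_modEq_one (k := P.natDegree)
      (B + q + P.leadingCoeff.natAbs) (by omega)
    have : NeZero q := ⟨hq.ne'⟩
    have : NeZero p := ⟨hp.ne_zero⟩
    have hcop : ∀ n, 0 < n → n < p → p.Coprime n := fun n h0 hn =>
      (hp.coprime_iff_not_dvd).2 fun h => absurd (Nat.le_of_dvd h0 h) (by omega)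
    refine ⟨q * p, Nat.mul_pos hq hp.pos, hqB.mul_left (hcop B hB (by omega)), ?_⟩
    have h1 := ncard_modRange_prime_le P hP hp (by omega) hmod
    have h2 := ncard_modRange_mul_le P (hcop q hq (by omega)).symm
    calc ((modRange P (q * p)).ncard : ℝ)
        ≤ (modRange P q).ncard * (modRange P p).ncard := by exact_mod_cast h2
      _ ≤ ((1 - 1 / (2 * P.natDegree)) ^ r * q) * ((1 - 1 / (2 * P.natDegree)) * p) := by gcongr
      _ = _ := by push_cast; ring

/-- The values of a polynomial of degree at least two have arbitrarily small density modulo a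
suitable `q`, which may be taken coprime to any given positive `B`. -/
theorem exists_modulus (P : ℤ[X]) (hP : 2 ≤ P.natDegree) {B : ℕ} (hB : 0 < B) {ε : ℝ}
    (hε : 0 < ε) :
    ∃ q : ℕ, 0 < q ∧ q.Coprime B ∧ ((modRange P q).ncard : ℝ) ≤ ε * q := by
  have hd : (2 : ℝ) ≤ P.natDegree := by exact_mod_cast hP
  obtain ⟨r, hr⟩ := exists_pow_lt_of_lt_one hε
    (show (1 - 1 / (2 * P.natDegree) : ℝ) < 1 by rw [sub_lt_self_iff]; positivity)
  obtain ⟨q, hq, hqB, h⟩ := exists_modulus_pow P hP hB r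
  exact ⟨q, hq, hqB, h.trans (by gcongr)⟩

theorem exists_shift_avoiding {q : ℕ} (hq : 0 < q) (V : Set (ZMod q)) (W : Finset ℤ)
    (h : W.card * V.ncard < q) : ∃ c : ZMod q, ∀ n ∈ W, c - (n : ZMod q) ∉ V := by
  have : NeZero q := ⟨hq.ne'⟩
  classical
  by_contra! hcon
  have hsub : (Finset.univ : Finset (ZMod q)) ⊆
      Finset.image (fun x : ℤ × ZMod q => x.2 + (x.1 : ZMod q)) (W ×ˢ V.toFinset) := by
    intro c _
    obtain ⟨n, hn, hc⟩ := hcon c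
    exact Finset.mem_image.2 ⟨(n, c - n), by simp [hn, hc], by simp⟩
  have := (Finset.card_le_card hsub).trans Finset.card_image_le
  rw [Finset.card_product, Finset.card_univ, ZMod.card, ← Set.ncard_eq_toFinset_card'] at this
  omega

theorem card_filter_residue_le {q : ℕ} (hq : 0 < q) (a b : ℤ) (hab : a ≤ b) (r : ZMod q) :
    (((Finset.Ico a b).filter fun n : ℤ => (n : ZMod q) = r).card : ℝ) ≤ (b - a) / q + 1 := by
  have : NeZero q := ⟨hq.ne'⟩
  have hq' : (0 : ℤ) < q := by exact_mod_cast hq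
  obtain ⟨v, rfl⟩ := ZMod.intCast_surjective r
  have h := Int.Ico_filter_modEq_card a b hq' v
  simp_rw [ZMod.intCast_eq_intCast_iff]
  have hQ : ((((Finset.Ico a b).filter fun n : ℤ => n ≡ v [ZMOD q]).card : ℤ) : ℚ)
      ≤ (b - a) / q + 1 := by
    rw [h]
    have hqq : (0 : ℚ) < q := by exact_mod_cast hq
    have hab' : (a : ℚ) ≤ b := by exact_mod_cast hab
    push_cast
    refine max_le ?_ (by have := div_nonneg (sub_nonneg.2 hab') hqq.le; linarith)
    have h1 := (Int.ceil_lt_add_one ((b - v) / (q : ℚ))).le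
    have h2 := Int.le_ceil ((a - v) / (q : ℚ))
    have : ((b : ℚ) - a) / q = (b - v) / q - (a - v) / q := by ring
    linarith
  have := (Rat.cast_le (K := ℝ)).2 hQ
  push_cast at this
  exact this

theorem card_filter_shift_mem_le {q : ℕ} (hq : 0 < q) (V : Set (ZMod q)) (c : ZMod q) (a b : ℤ)
    (hab : a ≤ b) [DecidablePred fun n : ℤ => c - (n : ZMod q) ∈ V] :
    (((Finset.Ico a b).filter fun n : ℤ => c - (n : ZMod q) ∈ V).card : ℝ)
      ≤ V.ncard * ((b - a) / q + 1) := by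
  have : NeZero q := ⟨hq.ne'⟩
  classical
  have hsub : ((Finset.Ico a b).filter fun n : ℤ => c - (n : ZMod q) ∈ V) ⊆
      V.toFinset.biUnion fun v => (Finset.Ico a b).filter fun n : ℤ => (n : ZMod q) = c - v := by
    intro n hn
    simp only [Finset.mem_filter] at hn
    simp only [Finset.mem_biUnion, Finset.mem_filter, Set.mem_toFinset]
    exact ⟨_, hn.2, hn.1, by ring⟩
  calc _ ≤ ((∑ v ∈ V.toFinset,
        ((Finset.Ico a b).filter fun n : ℤ => (n : ZMod q) = c - v).card : ℕ) : ℝ) := by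
        exact_mod_cast (Finset.card_le_card hsub).trans Finset.card_biUnion_le
    _ ≤ ∑ v ∈ V.toFinset, (((b : ℝ) - a) / q + 1) := by
        push_cast
        exact Finset.sum_le_sum fun v _ => card_filter_residue_le hq a b hab _
    _ = _ := by rw [Finset.sum_const, nsmul_eq_mul, Set.ncard_eq_toFinset_card']

theorem exists_modulus_shift (P : ℤ[X]) (hP : 2 ≤ P.natDegree) (N i : ℕ) :
    ∃ (q : ℕ) (c : ZMod q), 0 < q ∧ q.Coprime i.factorial ∧
      ((modRange P q).ncard : ℝ) ≤ q / 2 ^ (i + 4) ∧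
      ∀ n ∈ Finset.Ico (-(N : ℤ)) (N + 1), c - (n : ZMod q) ∉ modRange P q := by
  obtain ⟨q, hq, hcop, hcard⟩ := exists_modulus P hP i.factorial_pos
    (show (0 : ℝ) < 1 / (2 ^ (i + 4) * (2 * N + 2)) by positivity)
  have hq' : (0 : ℝ) < q := by exact_mod_cast hq
  have h1 : (1 : ℝ) ≤ 2 ^ (i + 4) := one_le_pow₀ (by norm_num)
  obtain ⟨c, hc⟩ := exists_shift_avoiding hq (modRange P q) (Finset.Ico (-(N : ℤ)) (N + 1)) (by
    have hW : (Finset.Ico (-(N : ℤ)) (N + 1)).card = 2 * N + 1 := by rw [Int.card_Ico]; omega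
    rw [hW, ← Nat.cast_lt (α := ℝ)]
    push_cast
    calc (2 * (N : ℝ) + 1) * (modRange P q).ncard
        ≤ (2 * N + 1) * (1 / (1 * (2 * N + 2)) * q) := by
          gcongr
          exact hcard.trans (by gcongr)
      _ = q * ((2 * N + 1) / (2 * N + 2)) := by field_simp
      _ < q * 1 := by
          gcongr
          rw [div_lt_one (by positivity)]
          linarith
      _ = q := mul_one _)
  refine ⟨q, c, hq, hcop, hcard.trans ?_, hc⟩
  rw [one_div_mul_eq_div]
  gcongr
  exact le_mul_of_one_le_right (by positivity) (by linarith [Nat.cast_nonneg (α := ℝ) N])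

theorem le_upperBanachDensityZ {E : Set ℤ} {δ : ℝ}
    (h : ∀ a : ℕ, ∃ N ≥ a, δ * (2 * N + 1) ≤ ((E ∩ {x | |x| ≤ (N : ℤ)}).ncard : ℝ)) :
    δ ≤ upperBanachDensityZ E := by
  have hball : ∀ (N : ℕ) (t : ℤ),
      ((E ∩ {x | |x - t| ≤ (N : ℤ)}).ncard : ℝ) / (2 * N + 1 : ℝ) ≤ 1 := by
    intro N t
    rw [div_le_one (by positivity)]
    have hsub : E ∩ {x | |x - t| ≤ (N : ℤ)} ⊆ (Finset.Icc (t - N) (t + N) : Finset ℤ) := by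
      rintro x ⟨-, hx⟩
      rw [Set.mem_ofPred_eq, abs_le] at hx
      rw [Finset.coe_Icc, Set.mem_Icc]
      omega
    have hle := Set.ncard_le_ncard hsub (Finset.finite_toSet _)
    rw [Set.ncard_coe_finset, Int.card_Icc] at hle
    have : (E ∩ {x | |x - t| ≤ (N : ℤ)}).ncard ≤ 2 * N + 1 := by omega
    exact_mod_cast this
  refine le_limsup_of_frequently_le ?_ ?_
  · rw [frequently_atTop]
    intro a
    obtain ⟨N, hN, hle⟩ := h a
    refine ⟨N, hN, ?_⟩
    have hbdd : BddAbove (Set.range fun t : ℤ =>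
        ((E ∩ {x | |x - t| ≤ (N : ℤ)}).ncard : ℝ) / (2 * N + 1 : ℝ)) :=
      ⟨1, by rintro _ ⟨t, rfl⟩; exact hball N t⟩
    refine le_trans ?_ (le_ciSup hbdd 0)
    rw [le_div_iff₀ (by positivity)]
    simpa using hle
  · exact isBoundedUnder_of ⟨1, fun N => ciSup_le (hball N)⟩

theorem exists_pos_mul_add_eq {q k : ℕ} (hq : 0 < q) (hk : q.Coprime k) (c x : ZMod q) :
    ∃ j : ℕ, 1 ≤ j ∧ j ≤ q ∧ x + j * k = c := by
  have : NeZero q := ⟨hq.ne'⟩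
  have hu : (k : ZMod q) * (k : ZMod q)⁻¹ = 1 := ZMod.coe_mul_inv_eq_one k hk.symm
  have hsol : x + ((c - x) * (k : ZMod q)⁻¹) * k = c := by
    linear_combination (c - x) * hu
  set z := (c - x) * (k : ZMod q)⁻¹
  rcases Nat.eq_zero_or_pos z.val with h | h
  · refine ⟨q, hq, le_rfl, ?_⟩
    rw [ZMod.natCast_self]
    rwa [(ZMod.val_eq_zero z).1 h] at hsol
  · exact ⟨z.val, h, (ZMod.val_lt z).le, by rwa [ZMod.natCast_rightInverse z]⟩

end

/-- **Theorem E (Counter-example to the pinned polynomial Bogolyubov theorem).**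
Let `P ∈ ℤ[n]` with `P(0) = 0` and `deg P ≥ 2`. There is a set `E ⊆ ℤ` with `d*(E) > 0`
such that for every positive `k` there is a positive `m` such that for all `x, y ∈ E`
there is `1 ≤ j ≤ m` for which `jk` cannot be written as `(e - x) + P(e' - y)` with
`e, e' ∈ E`. -/
theorem counterexample_pinned_polynomial_bogolyubov
    (P : Polynomial ℤ) (hP0 : P.eval 0 = 0) (hdeg : 2 ≤ P.natDegree) :
    ∃ E : Set ℤ, 0 < upperBanachDensityZ E ∧
      ∀ k : ℕ, 0 < k → ∃ m : ℕ, 0 < m ∧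
        ∀ x ∈ E, ∀ y ∈ E, ∃ j : ℕ, 1 ≤ j ∧ j ≤ m ∧
          ¬ ∃ e ∈ E, ∃ e' ∈ E, ((j : ℤ) * (k : ℤ)) = (e - x) + P.eval (e' - y) := by
  classical
  choose Q S hQ hcop hcard hS using exists_modulus_shift P hdeg
  obtain ⟨N, hN⟩ : ∃ N : ℕ → ℕ, ∀ i, N (i + 1) = N i + Q (N i) i + 1 :=
    ⟨fun i => Nat.rec 0 (fun i n => n + Q n i + 1) i, fun _ => rfl⟩
  have hmono : StrictMono N := strictMono_nat_of_lt_succ fun i => by rw [hN]; omega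
  set q : ℕ → ℕ := fun i => Q (N i) i with hq
  set B : ℕ → Set ℤ := fun i => {n | S (N i) i - (n : ZMod (q i)) ∈ modRange P (q i)} with hB
  refine ⟨{n | ∀ i, n ∉ B i}, ?_, ?_⟩
  · refine lt_of_lt_of_le (by norm_num : (0 : ℝ) < 1 / 2) (le_upperBanachDensityZ fun a => ?_)
    refine ⟨N a, hmono.le_apply, ?_⟩
    set W := Finset.Ico (-(N a : ℤ)) ((N a : ℤ) + 1) with hW
    have hWcard : (W.card : ℝ) = 2 * N a + 1 := by
      have : W.card = 2 * N a + 1 := by rw [hW, Int.card_Ico]; omega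
      rw [this]; push_cast; ring
    have hset : {n | ∀ i, n ∉ B i} ∩ {x : ℤ | |x| ≤ (N a : ℤ)} =
        (W.filter fun n => ∀ i, n ∉ B i : Finset ℤ) := by
      ext n
      simp only [Set.mem_inter_iff, Set.mem_ofPred_eq, Finset.coe_filter, hW, Finset.mem_Ico, abs_le,
        Int.lt_add_one_iff]
      tauto
    rw [hset, Set.ncard_coe_finset]
    have hcover : W ⊆ (W.filter fun n => ∀ i, n ∉ B i) ∪
        (Finset.range a).biUnion fun i => W.filter fun n => n ∈ B i := by
      intro n hn
      by_cases h : ∀ i, n ∉ B i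
      · exact Finset.mem_union_left _ (Finset.mem_filter.2 ⟨hn, h⟩)
      · push Not at h
        obtain ⟨i, hi⟩ := h
        refine Finset.mem_union_right _ (Finset.mem_biUnion.2 ⟨i, ?_, Finset.mem_filter.2 ⟨hn, hi⟩⟩)
        by_contra hia
        have hle : N a ≤ N i := hmono.monotone (by simpa using hia)
        refine hS (N i) i n ?_ hi
        rw [hW, Finset.mem_Ico] at hn
        rw [Finset.mem_Ico]
        omega
    have hle : (W.card : ℝ) ≤ (W.filter fun n => ∀ i, n ∉ B i).card +
        ∑ i ∈ Finset.range a, ((W.filter fun n => n ∈ B i).card : ℝ) := by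
      have := (Finset.card_le_card hcover).trans ((Finset.card_union_le _ _).trans
        (Nat.add_le_add_left Finset.card_biUnion_le _))
      exact_mod_cast this
    have hterm : ∀ i ∈ Finset.range a, ((W.filter fun n => n ∈ B i).card : ℝ) ≤
        (2 * N a + 1) / 8 * (1 / 2) ^ i := by
      intro i hi
      have hq0 : (0 : ℝ) < q i := by exact_mod_cast hQ (N i) i
      have hqN : q i ≤ N a := by
        have := hmono.monotone (Nat.succ_le_of_lt (Finset.mem_range.1 hi))
        rw [Nat.succ_eq_add_one, hN] at this
        simp only [hq]; omega
      have hqN' : (q i : ℝ) ≤ N a := by exact_mod_cast hqN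
      have h1 : (1 : ℝ) ≤ (2 * N a + 1) / q i := by
        rw [one_le_div hq0]; linarith
      refine (card_filter_shift_mem_le (hQ (N i) i) (modRange P (q i)) (S (N i) i)
        (-(N a : ℤ)) (N a + 1) (by omega)).trans ?_
      have hV : ((modRange P (q i)).ncard : ℝ) ≤ q i / 2 ^ (i + 4) := hcard (N i) i
      push_cast
      calc ((modRange P (q i)).ncard : ℝ) * (((N a : ℝ) + 1 - -(N a : ℝ)) / q i + 1)
          ≤ (q i / 2 ^ (i + 4)) * ((2 * N a + 1) / q i + (2 * N a + 1) / q i) := by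
            rw [show (N a : ℝ) + 1 - -(N a : ℝ) = 2 * N a + 1 by ring]
            gcongr
        _ = _ := by
            rw [pow_add, one_div, inv_pow]
            field_simp
            norm_num
    have hsum := (Finset.sum_le_sum hterm).trans_eq (Finset.mul_sum _ _ _).symm
    have hgeom : ((2 * N a + 1 : ℝ) / 8) * ∑ i ∈ Finset.range a, (1 / 2 : ℝ) ^ i ≤
        (2 * N a + 1) / 8 * 2 := by
      gcongr
      exact sum_geometric_two_le a
    have hpos : (0 : ℝ) ≤ N a := Nat.cast_nonneg _
    linarith
  · intro k hk
    have hck : (q k).Coprime k := (hcop (N k) k).coprime_dvd_right (Nat.dvd_factorial hk le_rfl)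
    refine ⟨q k, hQ (N k) k, fun x _ y _ => ?_⟩
    obtain ⟨j, hj1, hjq, hj⟩ := exists_pos_mul_add_eq (hQ (N k) k) hck (S (N k) k) (x : ZMod (q k))
    refine ⟨j, hj1, hjq, ?_⟩
    rintro ⟨e, he, e', -, heq⟩
    refine he k ⟨((e' - y : ℤ) : ZMod (q k)), ?_⟩
    have hcast := congrArg (Int.cast : ℤ → ZMod (q k)) heq
    push_cast at hcast
    have hev : Polynomial.aeval ((e' - y : ℤ) : ZMod (q k)) P =
        ((P.eval (e' - y) : ℤ) : ZMod (q k)) := by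
      have := Polynomial.aeval_algebraMap_apply_eq_algebraMap_eval (A := ZMod (q k)) (e' - y) P
      simpa only [algebraMap_int_eq, eq_intCast] using this
    simp only [hev]
    linear_combination hj - hcast
end

section
/- Dynamical theorem preceding quantitative simplices: For every integer d ≥ 2 and every real δ > 0 there exist positive integers k₀ = k₀(δ, d) and m₀ = m₀(δ, d) such that the following holds. For every ergodic measure-preserving ℤ^d-action T on a probability space (X, μ) and every measurable set A ⊆ X with μ(A) ≥ δ there exist positive integers k ≤ k₀ and m ≤ m₀ and a primitive vector v ∈ ℤ^d such that for every v₁, …, v_{d−1} ∈ ℤ^d there exist n₁, …, n_{d−1} ∈ ℤ with μ(A ∩ (T^{mv})⁻¹A ∩ (T^{n₁v + kv₁})⁻¹A ∩ … ∩ (T^{n_{d−1}v + kv_{d−1}})⁻¹A) > 0. -/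
open MeasureTheory Filter
open scoped symmDiff

/-- A measure-preserving `ℤ^d`-action on `(X, μ)`: a family of measurable maps
`(T v)_{v ∈ ℤ^d}` with `T 0 = id`, `T (v+w) = T v ∘ T w`, each preserving `μ`. -/
def IsMPAction {X : Type} [MeasurableSpace X] (d : ℕ)
    (T : (Fin d → ℤ) → X → X) (μ : Measure X) : Prop :=
  T 0 = id ∧ (∀ v w, T (v + w) = T v ∘ T w) ∧ ∀ v, MeasurePreserving (T v) μ μ

/-- The action is ergodic: every measurable set invariant (up to null sets) under
all the maps `T v` has measure `0` or `1`. -/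
def IsErgodicAction {X : Type} [MeasurableSpace X] (d : ℕ)
    (T : (Fin d → ℤ) → X → X) (μ : Measure X) : Prop :=
  IsMPAction d T μ ∧
    ∀ A : Set X, MeasurableSet A →
      (∀ v, μ ((T v ⁻¹' A) ∆ A) = 0) → μ A = 0 ∨ μ A = 1

/-- A vector `v ∈ ℤ^d` is primitive if the gcd of its components is `1`. -/
def IsPrimitiveVec {d : ℕ} (v : Fin d → ℤ) : Prop := Finset.univ.gcd v = 1

open scoped RealInnerProductSpace

section Hilbert

variable {E : Type*} [NormedAddCommGroup E] [InnerProductSpace ℝ E]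

/-- If the orthogonal projections onto the subspaces `K j` preserve each other's ranges and `x` is
orthogonal to every intersection of `e + 1` of these subspaces, then the squared norms of the
projections of `x` sum to at most `e * ‖x‖ ^ 2`. -/
lemma sum_norm_sq_starProjection_le {ι : Type*} [DecidableEq ι] (K : ι → Submodule ℝ E)
    [∀ i, (K i).HasOrthogonalProjection]
    (hK : ∀ i j, ∀ x ∈ K j, (K i).starProjection x ∈ K j) (S : Finset ι) :
    ∀ (e : ℕ) (x : E),
      (∀ s ⊆ S, s.card = e + 1 → ∀ z, (∀ j ∈ s, z ∈ K j) → ⟪x, z⟫ = 0) →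
      ∑ j ∈ S, ‖(K j).starProjection x‖ ^ 2 ≤ e * ‖x‖ ^ 2 := by
  induction S using Finset.induction_on with
  | empty => intro e x _; simp only [Finset.sum_empty]; positivity
  | insert i S hi ih =>
    intro e x hx
    rcases e with _ | e
    · refine le_of_eq ?_
      rw [Nat.cast_zero, zero_mul]
      refine Finset.sum_eq_zero fun j hj => ?_
      have : (K j).starProjection x = 0 := by
        rw [Submodule.starProjection_apply_eq_zero_iff, Submodule.mem_orthogonal']
        intro z hz
        exact hx {j} (by simpa using hj) (by simp) z (by simpa using hz)
      simp [this]
    · set y := (K i).starProjection x with hy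
      have hyK : y ∈ K i := Submodule.starProjection_apply_mem _ _
      have hzK : x - y ∈ (K i)ᗮ := Submodule.sub_starProjection_mem_orthogonal x
      have h1 := ih e y (by
        intro s hs hc z hz
        rw [hy, Submodule.inner_starProjection_left_eq_right]
        refine hx (insert i s) (Finset.insert_subset_insert i hs) ?_ _ ?_
        · rw [Finset.card_insert_of_notMem (fun h => hi (hs h)), hc]
        · intro j hj
          rcases Finset.mem_insert.1 hj with rfl | hj
          · exact Submodule.starProjection_apply_mem _ _
          · exact hK _ _ _ (hz j hj))
      have h2 := ih (e + 1) (x - y) (by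
        intro s hs hc z hz
        have hs' : s ⊆ insert i S := hs.trans (Finset.subset_insert i S)
        rw [inner_sub_left, hx s hs' hc z hz, hy, Submodule.inner_starProjection_left_eq_right,
          hx s hs' hc _ (fun j hj => hK _ _ _ (hz j hj)), sub_zero])
      have h3 : ∀ j, ‖(K j).starProjection x‖ ^ 2
          = ‖(K j).starProjection y‖ ^ 2 + ‖(K j).starProjection (x - y)‖ ^ 2 := by
        intro j
        have h0 : ⟪(K j).starProjection y, (K j).starProjection (x - y)⟫ = 0 := by
          rw [← Submodule.inner_starProjection_left_eq_right,
            Submodule.starProjection_eq_self_iff.2 (Submodule.starProjection_apply_mem _ _)]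
          exact (Submodule.mem_orthogonal _ _).1 hzK _ (hK _ _ _ hyK)
        have := norm_add_sq_eq_norm_sq_add_norm_sq_real h0
        rw [← map_add, add_sub_cancel] at this
        simpa [sq] using this
      have h4 : ‖x‖ ^ 2 = ‖y‖ ^ 2 + ‖x - y‖ ^ 2 := by
        have := norm_add_sq_eq_norm_sq_add_norm_sq_real
          ((Submodule.mem_orthogonal _ _).1 hzK _ hyK)
        rw [add_sub_cancel] at this
        simpa [sq] using this
      rw [Finset.sum_insert hi, Finset.sum_congr rfl fun j _ => h3 j, Finset.sum_add_distrib,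
        ← hy, h4]
      push_cast at h2 ⊢
      nlinarith

/-- The vectors fixed by all operators `U v` with `v ∈ S`. -/
def fixedSubspace {G : Type*} (U : G → E →ₗᵢ[ℝ] E) (S : Set G) : Submodule ℝ E where
  carrier := {x | ∀ v ∈ S, U v x = x}
  add_mem' ha hb v hv := by rw [map_add, ha v hv, hb v hv]
  zero_mem' v _ := map_zero _
  smul_mem' c x hx v hv := by rw [map_smul, hx v hv]

lemma mem_fixedSubspace {G : Type*} {U : G → E →ₗᵢ[ℝ] E} {S : Set G} {x : E} :
    x ∈ fixedSubspace U S ↔ ∀ v ∈ S, U v x = x := Iff.rfl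

lemma fixedSubspace_anti {G : Type*} (U : G → E →ₗᵢ[ℝ] E) {S S' : Set G} (h : S ⊆ S') :
    fixedSubspace U S' ≤ fixedSubspace U S :=
  fun _ hx v hv => hx v (h hv)

lemma isClosed_fixedSubspace {G : Type*} (U : G → E →ₗᵢ[ℝ] E) (S : Set G) :
    IsClosed (fixedSubspace U S : Set E) := by
  have : (fixedSubspace U S : Set E) = ⋂ v ∈ S, {x | U v x = x} := by
    ext x; simp [mem_fixedSubspace]
  rw [this]
  exact isClosed_biInter fun v _ => isClosed_eq (U v).continuous continuous_id

instance {G : Type*} [CompleteSpace E] (U : G → E →ₗᵢ[ℝ] E) (S : Set G) :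
    (fixedSubspace U S).HasOrthogonalProjection :=
  have : CompleteSpace (fixedSubspace U S) := (isClosed_fixedSubspace U S).completeSpace_coe
  inferInstance

section Action

variable {G : Type*} [AddCommGroup G] {U : G → E →ₗᵢ[ℝ] E}

lemma apply_mem_fixedSubspace (hU : ∀ v w x, U (v + w) x = U v (U w x)) {S : Set G} {x : E}
    (hx : x ∈ fixedSubspace U S) (w : G) : U w x ∈ fixedSubspace U S := by
  intro v hv
  rw [← hU, add_comm, hU, hx v hv]

lemma starProjection_mem_fixedSubspace [CompleteSpace E] (hU0 : ∀ x, U 0 x = x)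
    (hU : ∀ v w x, U (v + w) x = U v (U w x)) (S S' : Set G) {x : E}
    (hx : x ∈ fixedSubspace U S') :
    (fixedSubspace U S).starProjection x ∈ fixedSubspace U S' := by
  intro w hw
  refine (Submodule.eq_starProjection_of_mem_of_inner_eq_zero
    (apply_mem_fixedSubspace hU (Submodule.starProjection_apply_mem _ _) w) ?_).symm
  intro z hz
  have hz' := apply_mem_fixedSubspace hU hz (-w)
  have h1 : z = U w (U (-w) z) := by rw [← hU, add_neg_cancel, hU0]
  have h2 : x - U w ((fixedSubspace U S).starProjection x)
      = U w (x - (fixedSubspace U S).starProjection x) := by rw [map_sub, hx w hw]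
  rw [h2, h1, LinearIsometry.inner_map_map]
  exact Submodule.starProjection_inner_eq_zero _ _ hz'

lemma apply_zsmul_of_apply (hU0 : ∀ x, U 0 x = x)
    (hU : ∀ v w x, U (v + w) x = U v (U w x)) {v : G} {x : E} (hx : U v x = x) (n : ℤ) :
    U (n • v) x = x := by
  have hneg : U (-v) x = x := by
    conv_lhs => rw [← hx]
    rw [← hU, neg_add_cancel, hU0]
  induction n using Int.induction_on with
  | zero => simp [hU0]
  | succ n ih => rw [add_smul, one_smul, hU, hx, ih]
  | pred n ih => rw [sub_smul, one_smul, sub_eq_add_neg, hU, hneg, ih]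

lemma apply_sum_of_apply (hU0 : ∀ x, U 0 x = x)
    (hU : ∀ v w x, U (v + w) x = U v (U w x)) {ι : Type*} (s : Finset ι) (f : ι → G) {x : E}
    (hx : ∀ i ∈ s, U (f i) x = x) : U (∑ i ∈ s, f i) x = x := by
  classical
  induction s using Finset.induction_on with
  | empty => simp [hU0]
  | insert i s hi ih =>
    rw [Finset.sum_insert hi, hU, ih fun j hj => hx j (Finset.mem_insert_of_mem hj),
      hx i (Finset.mem_insert_self i s)]

end Action

end Hilbert

/-- The point `(1, j, j², …)` of the moment curve. -/
def momentVec (d : ℕ) (j : ℕ) : Fin d → ℤ := fun i => (j : ℤ) ^ (i : ℕ)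

lemma isPrimitiveVec_momentVec {d : ℕ} (hd : 0 < d) (j : ℕ) : IsPrimitiveVec (momentVec d j) := by
  have h : Finset.univ.gcd (momentVec d j) ∣ momentVec d j ⟨0, hd⟩ :=
    Finset.gcd_dvd (Finset.mem_univ _)
  have h1 : momentVec d j ⟨0, hd⟩ = 1 := by simp [momentVec]
  rw [h1] at h
  have h2 := Finset.normalize_gcd (s := Finset.univ) (f := momentVec d j)
  rw [IsPrimitiveVec, ← h2]
  exact normalize_eq_one.2 (isUnit_of_dvd_one h)

/-- Any `d` of the vectors `momentVec d j`, `j < N`, span a sublattice containing `M ℤ^d` for some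
common `M > 0`. -/
lemma exists_smul_eq_sum_momentVec (d N : ℕ) : ∃ M : ℕ, 0 < M ∧
    ∀ J : Fin d → Fin N, Function.Injective J → ∀ w : Fin d → ℤ,
      ∃ c : Fin d → ℤ, (M : ℤ) • w = ∑ i, c i • momentVec d (J i) := by
  classical
  let D : (Fin d → Fin N) → ℤ := fun J => (Matrix.vandermonde fun i => ((J i : ℕ) : ℤ)).det
  refine ⟨∏ J ∈ Finset.univ.filter fun J => D J ≠ 0, (D J).natAbs,
    Finset.prod_pos fun J hJ => Int.natAbs_pos.2 (Finset.mem_filter.1 hJ).2, ?_⟩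
  intro J hJ w
  have hD : D J ≠ 0 := by
    refine Matrix.det_vandermonde_ne_zero_iff.2 fun a b hab => hJ (Fin.ext ?_)
    exact_mod_cast hab
  have hdvd : D J ∣ ((∏ J ∈ Finset.univ.filter fun J => D J ≠ 0, (D J).natAbs : ℕ) : ℤ) := by
    rw [← Int.natAbs_dvd]
    exact Int.natCast_dvd_natCast.2 (Finset.dvd_prod_of_mem (fun J => (D J).natAbs)
      (Finset.mem_filter.2 ⟨Finset.mem_univ J, hD⟩))
  obtain ⟨q, hq⟩ := hdvd
  set V := Matrix.vandermonde fun i => ((J i : ℕ) : ℤ) with hV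
  have key : Matrix.vecMul (Matrix.vecMul w V.adjugate) V = D J • w := by
    rw [Matrix.vecMul_vecMul, Matrix.adjugate_mul, Matrix.vecMul_smul, Matrix.vecMul_one]
  refine ⟨q • Matrix.vecMul w V.adjugate, ?_⟩
  rw [hq, mul_comm, mul_smul, ← key]
  ext a
  simp only [Pi.smul_apply, smul_eq_mul, Finset.sum_apply, Matrix.vecMul, dotProduct,
    Finset.mul_sum, hV, Matrix.vandermonde_apply, momentVec]
  simp only [Finset.sum_mul, Finset.mul_sum, mul_assoc]

/-- A real sequence rising by at most `1` over `R` steps has a step of height at most `1 / R`. -/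
lemma exists_succ_sub_le_one_div {R : ℕ} (hR : 0 < R) (b : ℕ → ℝ) (h0 : 0 ≤ b 0) (h1 : b R ≤ 1) :
    ∃ i < R, b (i + 1) - b i ≤ 1 / R := by
  by_contra! h
  have h2 : ∑ _i ∈ Finset.range R, (1 / R : ℝ) < ∑ i ∈ Finset.range R, (b (i + 1) - b i) :=
    Finset.sum_lt_sum_of_nonempty ⟨0, by simpa using hR⟩ fun i hi => h i (Finset.mem_range.1 hi)
  rw [Finset.sum_range_sub, Finset.sum_const, Finset.card_range, nsmul_eq_mul,
    mul_one_div_cancel (by positivity)] at h2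
  linarith

/-- Directional projections approximate the projection onto the `k ℤ^d`-invariant vectors, with
`k` bounded in terms of `d` and `η` only. -/
lemma exists_starProjection_close (d : ℕ) (hd : 0 < d) (η : ℝ) (hη : 0 < η) :
    ∃ k₀ : ℕ, 0 < k₀ ∧ ∀ (E : Type) [NormedAddCommGroup E] [InnerProductSpace ℝ E]
      [CompleteSpace E] (U : (Fin d → ℤ) → E →ₗᵢ[ℝ] E), (∀ x, U 0 x = x) →
      (∀ v w x, U (v + w) x = U v (U w x)) → ∀ a : E, ‖a‖ ≤ 1 →
      ∃ k : ℕ, 0 < k ∧ k ≤ k₀ ∧ ∃ v, IsPrimitiveVec v ∧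
        ‖(fixedSubspace U {(k : ℤ) • v}).starProjection a -
          (fixedSubspace U (Set.range fun w : Fin d → ℤ => (k : ℤ) • w)).starProjection a‖ ≤ η := by
  obtain ⟨N, hN⟩ := exists_nat_gt (4 * d / η ^ 2)
  obtain ⟨R, hR⟩ := exists_nat_gt (4 / η ^ 2)
  obtain ⟨M, hM, hMJ⟩ := exists_smul_eq_sum_momentVec d N
  have hR0 : 0 < R := by
    have : (0 : ℝ) < R := lt_trans (by positivity) hR
    exact_mod_cast this
  have hN0 : 0 < N := by
    have : (0 : ℝ) < N := lt_of_le_of_lt (by positivity) hN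
    exact_mod_cast this
  refine ⟨M ^ R, by positivity, ?_⟩
  intro E _ _ _ U hU0 hU a ha
  let W : ℕ → Submodule ℝ E := fun i =>
    fixedSubspace U (Set.range fun w : Fin d → ℤ => ((M ^ i : ℕ) : ℤ) • w)
  have : ∀ i, (W i).HasOrthogonalProjection := fun i => by dsimp only [W]; infer_instance
  have hWmono : ∀ i, W i ≤ W (i + 1) := by
    intro i
    refine fixedSubspace_anti U ?_
    rintro _ ⟨w, rfl⟩
    refine ⟨(M : ℤ) • w, ?_⟩
    simp only [pow_succ, Nat.cast_mul, mul_smul]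
  have hPy : ∀ i, ‖(W (i + 1)).starProjection a - (W i).starProjection a‖ ^ 2
      = ‖(W (i + 1)).starProjection a‖ ^ 2 - ‖(W i).starProjection a‖ ^ 2 := by
    intro i
    have h1 : (W i).starProjection ((W (i + 1)).starProjection a) = (W i).starProjection a :=
      congrArg (fun f => f a) (Submodule.starProjection_comp_starProjection_of_le (hWmono i))
    have h2 : ⟪(W (i + 1)).starProjection a - (W i).starProjection a,
        (W i).starProjection a⟫ = 0 := by
      rw [← h1]
      exact Submodule.starProjection_inner_eq_zero _ _ (Submodule.starProjection_apply_mem _ _)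
    have := norm_add_sq_eq_norm_sq_add_norm_sq_real h2
    rw [sub_add_cancel] at this
    linarith
  obtain ⟨i, hiR, hi⟩ := exists_succ_sub_le_one_div hR0
    (fun i => ‖(W i).starProjection a‖ ^ 2) (by positivity)
    (pow_le_one₀ (norm_nonneg _) (((W R).norm_starProjection_apply_le a).trans ha))
  rw [← hPy] at hi
  set k := M ^ i with hk
  let K : Fin N → Submodule ℝ E := fun j => fixedSubspace U {(k : ℤ) • momentVec d j}
  have : ∀ j, (K j).HasOrthogonalProjection := fun i => by dsimp only [K]; infer_instance
  have hWK : ∀ j, W i ≤ K j := fun j => fixedSubspace_anti U (by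
    rintro _ rfl; exact ⟨momentVec d j, rfl⟩)
  set x := a - (W (i + 1)).starProjection a with hx
  have hxa : ‖x‖ ≤ 1 := by
    have := (W (i + 1))ᗮ.norm_starProjection_apply_le a
    rw [Submodule.starProjection_orthogonal_val] at this
    exact this.trans ha
  have hsum := sum_norm_sq_starProjection_le K
    (fun _ _ _ h => starProjection_mem_fixedSubspace hU0 hU _ _ h) Finset.univ (d - 1) x (by
      intro s _ hs z hz
      refine Submodule.starProjection_inner_eq_zero _ _ ?_
      rw [Nat.sub_add_cancel hd] at hs
      rintro _ ⟨w, rfl⟩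
      obtain ⟨c, hc⟩ := hMJ (s.orderEmbOfFin hs) (s.orderEmbOfFin hs).injective w
      have : ((M ^ (i + 1) : ℕ) : ℤ) • w
          = ∑ l, c l • ((k : ℤ) • momentVec d (s.orderEmbOfFin hs l)) := by
        rw [pow_succ, Nat.cast_mul, mul_smul, hc, Finset.smul_sum]
        exact Finset.sum_congr rfl fun l _ => smul_comm _ _ _
      simp only [this]
      exact apply_sum_of_apply hU0 hU _ _ fun l _ => apply_zsmul_of_apply hU0 hU
        (hz _ (s.orderEmbOfFin_mem hs l) _ rfl) _)
  obtain ⟨j, -, hj⟩ : ∃ j ∈ (Finset.univ : Finset (Fin N)),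
      ‖(K j).starProjection x‖ ^ 2 ≤ d / N := by
    refine Finset.exists_le_of_sum_le ⟨⟨0, hN0⟩, Finset.mem_univ _⟩ (hsum.trans ?_)
    rw [Finset.sum_const, Finset.card_univ, Fintype.card_fin, nsmul_eq_mul,
      mul_div_cancel₀ _ (by positivity)]
    have h1 : ((d - 1 : ℕ) : ℝ) ≤ d := by exact_mod_cast Nat.sub_le d 1
    have h2 : ‖x‖ ^ 2 ≤ 1 := pow_le_one₀ (norm_nonneg _) hxa
    calc ((d - 1 : ℕ) : ℝ) * ‖x‖ ^ 2 ≤ d * 1 := by gcongr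
      _ = d := mul_one _
  refine ⟨k, by positivity, Nat.pow_le_pow_right hM hiR.le, momentVec d j,
    isPrimitiveVec_momentVec hd j, ?_⟩
  change ‖(K j).starProjection a - (W i).starProjection a‖ ≤ η
  have hsplit : (K j).starProjection a - (W i).starProjection a
      = (K j).starProjection x
        + (K j).starProjection ((W (i + 1)).starProjection a - (W i).starProjection a) := by
    rw [hx, map_sub, map_sub, Submodule.starProjection_eq_self_iff.2
      (hWK j (Submodule.starProjection_apply_mem (W i) a))]
    abel
  have hb1 : ‖(K j).starProjection x‖ ≤ η / 2 := by
    refine abs_le_of_sq_le_sq' (hj.trans ?_) (by positivity) |>.2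
    rw [div_le_iff₀ (by positivity)]
    rw [div_lt_iff₀ (by positivity)] at hN
    nlinarith
  have hb2 : ‖(W (i + 1)).starProjection a - (W i).starProjection a‖ ≤ η / 2 := by
    refine abs_le_of_sq_le_sq' (hi.trans ?_) (by positivity) |>.2
    rw [div_le_iff₀ (by positivity)]
    rw [div_lt_iff₀ (by positivity)] at hR
    nlinarith
  rw [hsplit]
  refine (norm_add_le _ _).trans ?_
  have := ((K j).norm_starProjection_apply_le
    ((W (i + 1)).starProjection a - (W i).starProjection a)).trans hb2
  linarith

section Koopman

variable {X : Type*} [MeasurableSpace X] {μ : Measure X}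

/-- The Koopman operators on `L²(μ)` of a family of measure-preserving maps. -/
noncomputable def koopman {G : Type*} {T : G → X → X} (hT : ∀ v, MeasurePreserving (T v) μ μ)
    (v : G) : Lp ℝ 2 μ →ₗᵢ[ℝ] Lp ℝ 2 μ :=
  Lp.compMeasurePreservingₗᵢ ℝ (T v) (hT v)

lemma koopman_apply {G : Type*} {T : G → X → X} (hT : ∀ v, MeasurePreserving (T v) μ μ) (v : G)
    (f : Lp ℝ 2 μ) : koopman hT v f = Lp.compMeasurePreserving (T v) (hT v) f := rfl

lemma koopman_zero {G : Type*} [AddCommGroup G] {T : G → X → X}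
    (hT : ∀ v, MeasurePreserving (T v) μ μ) (h0 : T 0 = id) (f : Lp ℝ 2 μ) :
    koopman hT 0 f = f := by
  rw [koopman_apply]
  have : ∀ g (hg : MeasurePreserving g μ μ), g = id → Lp.compMeasurePreserving g hg f = f := by
    rintro g hg rfl
    exact Lp.compMeasurePreserving_id_apply f
  exact this _ _ h0

lemma koopman_add {G : Type*} [AddCommGroup G] {T : G → X → X}
    (hT : ∀ v, MeasurePreserving (T v) μ μ) (hadd : ∀ v w, T (v + w) = T v ∘ T w) (v w : G)
    (f : Lp ℝ 2 μ) : koopman hT (v + w) f = koopman hT v (koopman hT w f) := by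
  simp only [koopman_apply]
  have : ∀ g (hg : MeasurePreserving g μ μ), g = T w ∘ T v → Lp.compMeasurePreserving g hg f
      = Lp.compMeasurePreserving (T v) (hT v) (Lp.compMeasurePreserving (T w) (hT w) f) := by
    rintro g hg rfl
    exact Lp.compMeasurePreserving_comp_apply f (hT w) (hT v)
  exact this _ _ (by rw [add_comm, hadd])

variable [IsProbabilityMeasure μ]

lemma inner_indicatorConstLp_one_one {s t : Set X} (hs : MeasurableSet s) (ht : MeasurableSet t) :
    ⟪indicatorConstLp 2 hs (measure_ne_top μ s) (1 : ℝ),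
      indicatorConstLp 2 ht (measure_ne_top μ t) (1 : ℝ)⟫ = μ.real (s ∩ t) := by
  rw [L2.inner_indicatorConstLp_one, setIntegral_indicatorConstLp hs, smul_eq_mul, mul_one,
    Set.inter_comm]

lemma norm_indicatorConstLp_one_le_one {s : Set X} (hs : MeasurableSet s) :
    ‖indicatorConstLp 2 hs (measure_ne_top μ s) (1 : ℝ)‖ ≤ 1 := by
  refine abs_le_of_sq_le_sq' (b := 1) ?_ zero_le_one |>.2
  rw [← real_inner_self_eq_norm_sq, inner_indicatorConstLp_one_one, one_pow]
  exact measureReal_le_one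

lemma indicatorConstLp_mem_fixedSubspace {G : Type*} {T : G → X → X}
    (hT : ∀ v, MeasurePreserving (T v) μ μ) {S : Set G} {s : Set X} (hs : MeasurableSet s)
    (h : ∀ v ∈ S, T v ⁻¹' s =ᵐ[μ] s) :
    indicatorConstLp 2 hs (measure_ne_top μ s) (1 : ℝ) ∈ fixedSubspace (koopman hT) S := by
  intro v hv
  rw [koopman_apply, Lp.indicatorConstLp_compMeasurePreserving,
    indicatorConstLp_inj _ _ _ _ one_ne_zero]
  exact h v hv

/-- **Quantitative Poincaré recurrence.** -/
lemma exists_le_measureReal_inter_preimage_iterate {c : ℝ} (hc : 0 < c) {L : ℕ}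
    (hL : 2 / c ^ 2 < L) {f : X → X} (hf : MeasurePreserving f μ μ) {s : Set X}
    (hs : MeasurableSet s) (hcs : c ≤ μ.real s) :
    ∃ m, 0 < m ∧ m ≤ L ∧ c ^ 2 / 2 ≤ μ.real (s ∩ f^[m] ⁻¹' s) := by
  by_contra! hcon
  have hm : ∀ i, MeasurableSet (f^[i] ⁻¹' s) := fun i => (hf.iterate i).measurable hs
  let x : ℕ → Lp ℝ 2 μ := fun i => indicatorConstLp 2 (hm i) (measure_ne_top μ _) (1 : ℝ)
  let e : Lp ℝ 2 μ := indicatorConstLp 2 MeasurableSet.univ (measure_ne_top μ _) (1 : ℝ)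
  have hlt : ∀ i j, i < j → j ≤ L → ⟪x i, x j⟫ ≤ c ^ 2 / 2 := by
    intro i j hij hj
    have h1 : f^[i] ⁻¹' s ∩ f^[j] ⁻¹' s = f^[i] ⁻¹' (s ∩ f^[j - i] ⁻¹' s) := by
      rw [Set.preimage_inter, ← Set.preimage_comp, ← Function.iterate_add, Nat.sub_add_cancel hij.le]
    rw [inner_indicatorConstLp_one_one, h1,
      (hf.iterate i).measureReal_preimage (hs.inter (hm _)).nullMeasurableSet]
    exact (hcon _ (Nat.sub_pos_of_lt hij) ((Nat.sub_le _ _).trans hj)).le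
  have hle : ∀ i ∈ Finset.range L, ∀ j ∈ Finset.range L,
      ⟪x i, x j⟫ ≤ (if i = j then 1 else 0) + c ^ 2 / 2 := by
    intro i hi j hj
    rw [Finset.mem_range] at hi hj
    rcases lt_trichotomy i j with h | h | h
    · rw [if_neg h.ne, zero_add]; exact hlt i j h hj.le
    · rw [if_pos h, inner_indicatorConstLp_one_one]
      have : μ.real (f^[i] ⁻¹' s ∩ f^[j] ⁻¹' s) ≤ 1 := measureReal_le_one
      have : 0 < c ^ 2 / 2 := by positivity
      linarith
    · rw [if_neg h.ne', zero_add, real_inner_comm]; exact hlt j i h hi.le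
  have hsq : ‖∑ i ∈ Finset.range L, x i‖ ^ 2 ≤ L + L * (L * (c ^ 2 / 2)) := by
    rw [← real_inner_self_eq_norm_sq, sum_inner]
    simp only [inner_sum]
    refine (Finset.sum_le_sum fun i hi => Finset.sum_le_sum fun j hj => hle i hi j hj).trans ?_
    refine (Finset.sum_le_sum (g := fun _ => 1 + L * (c ^ 2 / 2)) fun i hi => ?_).trans ?_
    · rw [Finset.sum_add_distrib, Finset.sum_ite_eq, if_pos hi]
      simp
    · simp
  have hlow : L * c ≤ ‖∑ i ∈ Finset.range L, x i‖ := by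
    have h1 : L * c ≤ ⟪∑ i ∈ Finset.range L, x i, e⟫ := by
      rw [sum_inner]
      have : ∀ i ∈ Finset.range L, c ≤ ⟪x i, e⟫ := by
        intro i _
        rw [inner_indicatorConstLp_one_one, Set.inter_univ,
          (hf.iterate i).measureReal_preimage hs.nullMeasurableSet]
        exact hcs
      simpa using Finset.card_nsmul_le_sum _ _ _ this
    refine h1.trans ((real_inner_le_norm _ _).trans ?_)
    exact mul_le_of_le_one_right (norm_nonneg _) (norm_indicatorConstLp_one_le_one _)
  have hL0 : (0 : ℝ) < L := lt_trans (by positivity) hL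
  have h2 : (L * c) ^ 2 ≤ L + L * (L * (c ^ 2 / 2)) :=
    (pow_le_pow_left₀ (by positivity) hlow 2).trans hsq
  rw [div_lt_iff₀ (by positivity)] at hL
  nlinarith

end Koopman

section Action

variable {X : Type} [MeasurableSpace X] {μ : Measure X} {d : ℕ} {T : (Fin d → ℤ) → X → X}

lemma IsMPAction.preimage_add (hT : IsMPAction d T μ) (v w : Fin d → ℤ) (s : Set X) :
    T (v + w) ⁻¹' s = T w ⁻¹' (T v ⁻¹' s) := by
  rw [hT.2.1, Set.preimage_comp]

lemma IsMPAction.iterate (hT : IsMPAction d T μ) (v : Fin d → ℤ) (m : ℕ) :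
    (T v)^[m] = T ((m : ℤ) • v) := by
  induction m with
  | zero => simp [hT.1]
  | succ m ih => rw [Function.iterate_succ, ih, ← hT.2.1, Nat.cast_succ, add_smul, one_smul]

/-- The union of all translates of `A` in direction `u` is invariant under `T u`. -/
lemma IsMPAction.preimage_iUnion_zsmul (hT : IsMPAction d T μ) (u : Fin d → ℤ) (A : Set X) :
    T u ⁻¹' (⋃ n : ℤ, T (n • u) ⁻¹' A) = ⋃ n : ℤ, T (n • u) ⁻¹' A := by
  simp only [Set.preimage_iUnion, ← hT.preimage_add]
  refine (Equiv.addRight (1 : ℤ)).iSup_congr fun n => ?_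
  simp [add_smul]

variable [IsProbabilityMeasure μ]

/-- If the conditional expectations of `1_A` on the `u`-invariant and on the `k ℤ^d`-invariant
functions are close in `L²`, where `u ∈ k ℤ^d`, then some `k ℤ^d`-invariant set contains half of
`A` and is almost covered by the translates of `A` in direction `u`. -/
lemma IsMPAction.exists_invariant_set (hT : IsMPAction d T μ) {A : Set X} (hA : MeasurableSet A)
    {δ : ℝ} (hδ : 0 < δ) (hδA : δ ≤ μ.real A) {S : Set (Fin d → ℤ)} {u : Fin d → ℤ} (hu : u ∈ S)
    {η : ℝ}
    (hη : ‖(fixedSubspace (koopman hT.2.2) {u}).starProjection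
          (indicatorConstLp 2 hA (measure_ne_top μ A) (1 : ℝ)) -
        (fixedSubspace (koopman hT.2.2) S).starProjection
          (indicatorConstLp 2 hA (measure_ne_top μ A) (1 : ℝ))‖ ≤ η) :
    ∃ D : Set X, MeasurableSet D ∧ (∀ v ∈ S, T v ⁻¹' D =ᵐ[μ] D) ∧ δ / 2 ≤ μ.real (A ∩ D) ∧
      δ / 2 * μ.real (D \ ⋃ n : ℤ, T (n • u) ⁻¹' A) ≤ η := by
  set a := indicatorConstLp 2 hA (measure_ne_top μ A) (1 : ℝ) with ha
  set f := (fixedSubspace (koopman hT.2.2) {u}).starProjection a with hf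
  set g := (fixedSubspace (koopman hT.2.2) S).starProjection a with hg
  have hgm : Measurable g := (Lp.stronglyMeasurable g).measurable
  have hgint : Integrable g μ := (Lp.memLp g).integrable one_le_two
  set D : Set X := {x | δ / 2 ≤ g x} with hD
  have hDm : MeasurableSet D := measurableSet_le measurable_const hgm
  have hDinv : ∀ v ∈ S, T v ⁻¹' D =ᵐ[μ] D := by
    intro v hv
    have h1 : koopman hT.2.2 v g = g :=
      mem_fixedSubspace.1 (Submodule.starProjection_apply_mem _ a) v hv
    have h2 := Lp.coeFn_compMeasurePreserving g (hT.2.2 v)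
    rw [← koopman_apply, h1] at h2
    filter_upwards [h2] with x hx
    have hx' : g (T v x) = g x := hx.symm
    change (δ / 2 ≤ g (T v x)) = (δ / 2 ≤ g x)
    rw [hx']
  refine ⟨D, hDm, hDinv, ?_, ?_⟩
  · have hmem := indicatorConstLp_mem_fixedSubspace hT.2.2 hDm.compl
      fun v hv => (hDinv v hv).compl
    have h1 : μ.real (A ∩ Dᶜ) = ∫ x in Dᶜ, g x ∂μ := by
      rw [← inner_indicatorConstLp_one_one hA hDm.compl,
        ← L2.inner_indicatorConstLp_one (𝕜 := ℝ) hDm.compl (measure_ne_top μ _) g, hg,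
        ← Submodule.inner_starProjection_left_eq_right,
        Submodule.starProjection_eq_self_iff.2 hmem, real_inner_comm]
    have h2 : ∫ x in Dᶜ, g x ∂μ ≤ δ / 2 * μ.real Dᶜ := by
      rw [mul_comm, ← smul_eq_mul, ← setIntegral_const]
      exact setIntegral_mono_on hgint.integrableOn (integrable_const _).integrableOn hDm.compl
        fun x hx => (not_le.1 (show ¬ δ / 2 ≤ g x from hx)).le
    have h3 : μ.real Dᶜ ≤ 1 := measureReal_le_one
    have h4 := measureReal_inter_add_sdiff (μ := μ) (s := A) hDm
    rw [Set.sdiff_eq] at h4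
    nlinarith
  · set H := ⋃ n : ℤ, T (n • u) ⁻¹' A with hH
    have hHm : MeasurableSet H := MeasurableSet.iUnion fun n => (hT.2.2 _).measurable hA
    have hEm : MeasurableSet (D \ H) := hDm.diff hHm
    have hmem := indicatorConstLp_mem_fixedSubspace hT.2.2 (S := {u}) hEm (by
      rintro _ rfl
      rw [Set.preimage_sdiff, hT.preimage_iUnion_zsmul]
      exact (hDinv _ hu).diff (Filter.EventuallyEq.refl _ _))
    set b := indicatorConstLp 2 hEm (measure_ne_top μ (D \ H)) (1 : ℝ) with hb
    have hAH : A ⊆ H := fun x hx => Set.mem_iUnion.2 ⟨0, by simpa [hT.1] using hx⟩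
    have h1 : ⟪b, f⟫ = 0 := by
      rw [hf, ← Submodule.inner_starProjection_left_eq_right,
        Submodule.starProjection_eq_self_iff.2 hmem, inner_indicatorConstLp_one_one]
      have : (D \ H) ∩ A = ∅ := by
        ext x; simp only [Set.mem_inter_iff, Set.mem_sdiff, Set.mem_empty_iff_false, iff_false]
        exact fun h => h.1.2 (hAH h.2)
      simp [this]
    have h2 : δ / 2 * μ.real (D \ H) ≤ ⟪b, g⟫ := by
      rw [hb, L2.inner_indicatorConstLp_one, mul_comm, ← smul_eq_mul, ← setIntegral_const]
      exact setIntegral_mono_on (integrable_const _).integrableOn hgint.integrableOn hEm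
        fun x hx => hx.1
    have h3 : ⟪b, g⟫ = -⟪b, f - g⟫ := by rw [inner_sub_right, h1]; ring
    have h4 : -⟪b, f - g⟫ ≤ ‖b‖ * ‖f - g‖ := (neg_le_abs _).trans (abs_real_inner_le_norm _ _)
    have h5 : ‖b‖ * ‖f - g‖ ≤ ‖f - g‖ :=
      mul_le_of_le_one_left (norm_nonneg _) (norm_indicatorConstLp_one_le_one _)
    linarith

end Action

/-- **Dynamical theorem preceding quantitative simplices.** For every `d ≥ 2` and `δ > 0`
there are `k₀ = k₀(δ, d)` and `m₀ = m₀(δ, d)` such that for every ergodic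
measure-preserving `ℤ^d`-action `T` on a probability space `(X, μ)` and every measurable
`A` with `μ(A) ≥ δ` there are positive integers `k ≤ k₀`, `m ≤ m₀` and a primitive vector
`v ∈ ℤ^d` such that for all `v₁, …, v_{d-1} ∈ ℤ^d` there are `n₁, …, n_{d-1} ∈ ℤ` with
`μ(A ∩ (T^{mv})⁻¹A ∩ (T^{n₁v + kv₁})⁻¹A ∩ … ∩ (T^{n_{d-1}v + kv_{d-1}})⁻¹A) > 0`. -/
theorem dynamical_quantitative_simplices
    (d : ℕ) (hd : 2 ≤ d) (δ : ℝ) (hδ : 0 < δ) :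
    ∃ k₀ : ℕ, 0 < k₀ ∧ ∃ m₀ : ℕ, 0 < m₀ ∧
      ∀ (X : Type) (_ : MeasurableSpace X) (μ : Measure X) (_ : IsProbabilityMeasure μ)
        (T : (Fin d → ℤ) → X → X), IsErgodicAction d T μ →
        ∀ A : Set X, MeasurableSet A → δ ≤ (μ A).toReal →
          ∃ k : ℕ, 0 < k ∧ k ≤ k₀ ∧ ∃ m : ℕ, 0 < m ∧ m ≤ m₀ ∧
            ∃ v : Fin d → ℤ, IsPrimitiveVec v ∧
              ∀ w : Fin (d - 1) → (Fin d → ℤ), ∃ n : Fin (d - 1) → ℤ,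
                0 < μ (A ∩ T ((m : ℤ) • v) ⁻¹' A ∩
                  ⋂ i, T ((n i) • v + (k : ℤ) • (w i)) ⁻¹' A) := by
  have hd0 : 0 < d := by omega
  have hdR : (0 : ℝ) < d := by exact_mod_cast hd0
  set η : ℝ := δ ^ 3 / (32 * d) with hη
  obtain ⟨k₀, hk₀, hmain⟩ := exists_starProjection_close d hd0 η (by positivity)
  obtain ⟨L, hL⟩ := exists_nat_gt (2 / (δ / 2) ^ 2)
  have hL0 : 0 < L := by
    have : (0 : ℝ) < L := lt_trans (by positivity) hL
    exact_mod_cast this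
  refine ⟨k₀, hk₀, L * k₀, by positivity, ?_⟩
  intro X _ μ _ T hTe A hA hδA
  have hT := hTe.1
  obtain ⟨k, hk, hkk, v, hv, hclose⟩ := hmain (Lp ℝ 2 μ) (koopman hT.2.2)
    (koopman_zero hT.2.2 hT.1) (koopman_add hT.2.2 hT.2.1) _ (norm_indicatorConstLp_one_le_one hA)
  obtain ⟨D, hDm, hDinv, hAD, hDH⟩ :=
    hT.exists_invariant_set hA hδ hδA (Set.mem_range_self v) hclose
  set u := (k : ℤ) • v with hu
  set H := ⋃ n : ℤ, T (n • u) ⁻¹' A with hH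
  have hHm : MeasurableSet H := MeasurableSet.iUnion fun n => (hT.2.2 _).measurable hA
  obtain ⟨m, hm0, hmL, hm⟩ := exists_le_measureReal_inter_preimage_iterate (half_pos hδ) hL
    (hT.2.2 u) (hA.inter hDm) hAD
  rw [hT.iterate] at hm
  refine ⟨k, hk, hkk, m * k, by positivity, Nat.mul_le_mul hmL hkk, v, hv, fun w => ?_⟩
  have hmk : ((m * k : ℕ) : ℤ) • v = (m : ℤ) • u := by rw [Nat.cast_mul, mul_smul]
  rw [hmk]
  set B := A ∩ D ∩ T ((m : ℤ) • u) ⁻¹' (A ∩ D) with hB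
  have hbad : ∀ i, μ.real (D \ T ((k : ℤ) • w i) ⁻¹' H) ≤ δ ^ 2 / (16 * d) := by
    intro i
    have h1 : μ.real (D \ T ((k : ℤ) • w i) ⁻¹' H) = μ.real (D \ H) := by
      rw [← (hT.2.2 ((k : ℤ) • w i)).measureReal_preimage (hDm.diff hHm).nullMeasurableSet,
        Set.preimage_sdiff]
      exact measureReal_congr
        ((hDinv _ (Set.mem_range_self (w i))).symm.diff (Filter.EventuallyEq.refl _ _))
    have h2 : η = δ / 2 * (δ ^ 2 / (16 * d)) := by rw [hη]; field_simp; norm_num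
    rw [h1]
    rw [h2] at hDH
    exact le_of_mul_le_mul_left hDH (half_pos hδ)
  have hpos : 0 < μ (B ∩ ⋂ i, T ((k : ℤ) • w i) ⁻¹' H) := by
    by_contra h0
    have h0 : μ.real (B ∩ ⋂ i, T ((k : ℤ) • w i) ⁻¹' H) = 0 := by
      rw [measureReal_def, nonpos_iff_eq_zero.1 (not_lt.1 h0), ENNReal.toReal_zero]
    have hsub : B ⊆ (B ∩ ⋂ i, T ((k : ℤ) • w i) ⁻¹' H) ∪
        ⋃ i, (D \ T ((k : ℤ) • w i) ⁻¹' H) := by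
      intro x hx
      by_cases hxi : ∀ i, x ∈ T ((k : ℤ) • w i) ⁻¹' H
      · exact Or.inl ⟨hx, Set.mem_iInter.2 hxi⟩
      · obtain ⟨i, hi⟩ := not_forall.1 hxi
        exact Or.inr (Set.mem_iUnion.2 ⟨i, hx.1.2, hi⟩)
    have h1 := (measureReal_mono (μ := μ) hsub).trans (measureReal_union_le _ _)
    have h2 : μ.real (⋃ i, (D \ T ((k : ℤ) • w i) ⁻¹' H)) ≤ δ ^ 2 / 16 := by
      refine (measureReal_iUnion_fintype_le _).trans ((Finset.sum_le_sum fun i _ => hbad i).trans ?_)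
      rw [Finset.sum_const, Finset.card_univ, Fintype.card_fin, nsmul_eq_mul]
      have h3 : ((d - 1 : ℕ) : ℝ) ≤ d := by exact_mod_cast Nat.sub_le d 1
      calc ((d - 1 : ℕ) : ℝ) * (δ ^ 2 / (16 * d)) ≤ d * (δ ^ 2 / (16 * d)) := by gcongr
        _ = δ ^ 2 / 16 := by field_simp
    have h4 : 0 < δ ^ 2 := by positivity
    rw [h0] at h1
    nlinarith
  have hcover : B ∩ ⋂ i, T ((k : ℤ) • w i) ⁻¹' H ⊆ ⋃ n : Fin (d - 1) → ℤ,
      A ∩ T ((m : ℤ) • u) ⁻¹' A ∩ ⋂ i, T ((n i * k) • v + (k : ℤ) • w i) ⁻¹' A := by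
    rintro x ⟨hxB, hxH⟩
    have hx : ∀ i, ∃ n : ℤ, x ∈ T (n • u + (k : ℤ) • w i) ⁻¹' A := by
      intro i
      obtain ⟨n, hn⟩ := Set.mem_iUnion.1 (Set.mem_iInter.1 hxH i)
      exact ⟨n, by rw [hT.preimage_add]; exact hn⟩
    choose n hn using hx
    refine Set.mem_iUnion.2 ⟨n, ⟨hxB.1.1, hxB.2.1⟩, Set.mem_iInter.2 fun i => ?_⟩
    rw [mul_smul]
    exact hn i
  obtain ⟨n, hn⟩ := exists_measure_pos_of_not_measure_iUnion_null
    (hpos.trans_le (measure_mono hcover)).ne'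
  exact ⟨fun i => n i * k, hn⟩
end
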